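/- arXiv:2509.08258 — 12 statements merged into one kernel-verified Lean document; each statement's English description precedes it below -/
import Mathlib

section
/- Under Assumption 1 (F is μ_F-strongly convex and L_F-smooth, G is μ_G-strongly convex and L_G-smooth), let (x_k, y_k)_{k≥1} be iterates of the primal-dual scheme with step sizes r ≤ 1/L_F, s ≤ 1/L_G and θ = min{√(μ_F r), √(μ_G s)}, and let (x*, y*) be the unique saddle point of L. Then for every k ≥ 1: L(x_{k+1}, y*) − L(x*, y_{k+1}) ≤ (1 − θ)(L(x_k, y*) − L(x*, y_k)) − (1/r)⟨x_{k+1} − x̄_k, x̄_k − θx* − (1 − θ)x_k⟩ − (1/(2r))‖x_{k+1} − x̄_k‖² − (μ_F θ/2)‖x̄_k − x*‖² − (1/s)⟨y_{k+1} − ȳ_k, ȳ_k − θy* − (1 − θ)y_k⟩ − (1/(2s))‖y_{k+1} − ȳ_k‖² − (μ_G θ/2)‖ȳ_k − y*‖². -/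
open scoped RealInnerProductSpace

/-- The descent lemma: a function with `K`-Lipschitz gradient lies below its quadratic upper model. -/
theorem le_add_inner_add_of_lipschitz_gradient {E : Type*} [NormedAddCommGroup E]
    [InnerProductSpace ℝ E] [CompleteSpace E] {f : E → ℝ} {f' : E → E} {K : ℝ}
    (hf : ∀ z, HasGradientAt f (f' z) z) (hK : ∀ a b, ‖f' b - f' a‖ ≤ K * ‖b - a‖) (a b : E) :
    f b ≤ f a + ⟪f' a, b - a⟫ + K / 2 * ‖b - a‖ ^ 2 := by
  set d := b - a with hd
  let g : ℝ → ℝ := fun t => f (a + t • d) - t * ⟪f' a, d⟫ - K / 2 * ‖d‖ ^ 2 * t ^ 2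
  have hg : ∀ t, HasDerivAt g
      (⟪f' (a + t • d), d⟫ - ⟪f' a, d⟫ - K / 2 * ‖d‖ ^ 2 * (2 * t)) t := by
    intro t
    have hline : HasDerivAt (fun t : ℝ => a + t • d) d t := by
      simpa using ((hasDerivAt_id t).smul_const d).const_add a
    have hcomp : HasDerivAt (fun t : ℝ => f (a + t • d)) ⟪f' (a + t • d), d⟫ t := by
      simpa [Function.comp_def] using
        (hf (a + t • d)).hasFDerivAt.comp_hasDerivAt t hline
    have hlin : HasDerivAt (fun t : ℝ => t * ⟪f' a, d⟫) ⟪f' a, d⟫ t := by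
      simpa using (hasDerivAt_id t).mul_const ⟪f' a, d⟫
    have hsq : HasDerivAt (fun t : ℝ => K / 2 * ‖d‖ ^ 2 * t ^ 2)
        (K / 2 * ‖d‖ ^ 2 * (2 * t)) t := by
      simpa using (hasDerivAt_pow 2 t).const_mul (K / 2 * ‖d‖ ^ 2)
    exact (hcomp.sub hlin).sub hsq
  have hanti : AntitoneOn g (Set.Icc 0 1) := by
    refine antitoneOn_of_deriv_nonpos (convex_Icc 0 1)
      (fun t _ => (hg t).continuousAt.continuousWithinAt)
      (fun t _ => (hg t).differentiableAt.differentiableWithinAt) fun t ht => ?_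
    rw [interior_Icc] at ht
    rw [(hg t).deriv, ← inner_sub_left]
    have hnorm : ‖f' (a + t • d) - f' a‖ ≤ K * (t * ‖d‖) := by
      simpa [norm_smul, abs_of_pos ht.1] using hK a (a + t • d)
    nlinarith [real_inner_le_norm (f' (a + t • d) - f' a) d,
      mul_le_mul_of_nonneg_right hnorm (norm_nonneg d)]
  have h01 := hanti (Set.left_mem_Icc.2 zero_le_one) (Set.right_mem_Icc.2 zero_le_one) zero_le_one
  simp only [g, hd, one_smul, zero_smul, add_zero, add_sub_cancel] at h01
  linarith

/-- One inertial gradient step with perturbation `v`, compared with the convex-type combination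
`θ • u + (1 - θ) • w`. -/
theorem inertial_gradient_step_le {E : Type*} [NormedAddCommGroup E]
    [InnerProductSpace ℝ E] [CompleteSpace E] {f : E → ℝ} {f' : E → E} {μ K r θ : ℝ}
    (hf : ∀ z, HasGradientAt f (f' z) z) (hμ : 0 < μ)
    (hsc : ∀ a b, f b ≥ f a + ⟪f' a, b - a⟫ + μ / 2 * ‖b - a‖ ^ 2)
    (hK : ∀ a b, ‖f' b - f' a‖ ≤ K * ‖b - a‖)
    (hr0 : 0 < r) (hr : r ≤ 1 / K) (hθ0 : 0 ≤ θ) (hθ : θ ≤ √(μ * r))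
    {p q v : E} (hp : p = q - r • (f' q + v)) (u w : E) :
    f p ≤ θ * f u + (1 - θ) * f w - ⟪v, p - θ • u - (1 - θ) • w⟫
      - (1 / r) * ⟪p - q, q - θ • u - (1 - θ) • w⟫
      - 1 / (2 * r) * ‖p - q‖ ^ 2 - μ * θ / 2 * ‖q - u‖ ^ 2 := by
  have hK0 : 0 < K := one_div_pos.1 (hr0.trans_le hr)
  have hrK : r * K ≤ 1 := (le_div_iff₀ hK0).1 hr
  have hdesc : f p ≤ f q + ⟪f' q, p - q⟫ + 1 / (2 * r) * ‖p - q‖ ^ 2 := by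
    refine (le_add_inner_add_of_lipschitz_gradient hf hK q p).trans ?_
    have : K / 2 ≤ 1 / (2 * r) := by
      rw [div_le_div_iff₀ two_pos (by positivity)]
      linarith
    gcongr
  have hw : 0 ≤ (1 - θ) * (f w - f q - ⟪f' q, w - q⟫) := by
    by_cases h1 : θ ≤ 1
    · have := hsc q w
      exact mul_nonneg (by linarith) (by nlinarith [sq_nonneg ‖w - q‖])
    · have hμr : 1 < μ * r := by
        by_contra! h
        exact h1 (hθ.trans (Real.sqrt_le_one.2 h))
      have hKμ : K < μ := by nlinarith
      have hmono : μ * ‖w - q‖ ^ 2 ≤ ⟪f' w - f' q, w - q⟫ := by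
        have h₁ := hsc q w
        have h₂ := hsc w q
        rw [norm_sub_rev q w, ← neg_sub w q, inner_neg_right] at h₂
        rw [inner_sub_left]
        linarith
      have hsq : ‖w - q‖ = 0 := by
        have := real_inner_le_norm (f' w - f' q) (w - q)
        have := mul_le_mul_of_nonneg_right (hK q w) (norm_nonneg (w - q))
        have : (μ - K) * ‖w - q‖ ^ 2 ≤ 0 := by nlinarith
        have : ‖w - q‖ ^ 2 = 0 :=
          le_antisymm (nonpos_of_mul_nonpos_right this (sub_pos.2 hKμ)) (sq_nonneg _)
        exact pow_eq_zero_iff two_ne_zero |>.1 this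
      rw [sub_eq_zero.1 (norm_eq_zero.1 hsq)]
      simp
  have hu := mul_le_mul_of_nonneg_left (hsc q u) hθ0
  rw [norm_sub_rev u q] at hu
  have hgrad : f' q = -(1 / r) • (p - q) - v := by
    rw [hp, sub_sub_cancel_left, neg_smul, smul_neg, neg_neg, smul_smul,
      one_div_mul_cancel hr0.ne', one_smul, add_sub_cancel_right]
  have hkey : ⟪f' q, p - q⟫ - θ * ⟪f' q, u - q⟫ - (1 - θ) * ⟪f' q, w - q⟫
      = -⟪v, p - θ • u - (1 - θ) • w⟫ - (1 / r) * ⟪p - q, q - θ • u - (1 - θ) • w⟫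
        - (1 / r) * ‖p - q‖ ^ 2 := by
    have hsplit : p - θ • u - (1 - θ) • w = (p - q) + (q - θ • u - (1 - θ) • w) := by abel
    have hcomb : ⟪f' q, p - q⟫ - θ * ⟪f' q, u - q⟫ - (1 - θ) * ⟪f' q, w - q⟫
        = ⟪f' q, p - θ • u - (1 - θ) • w⟫ := by
      simp only [inner_sub_right, inner_smul_right]
      ring
    rw [hcomb, hgrad, inner_sub_left, real_inner_smul_left]
    nth_rewrite 1 [hsplit]
    rw [inner_add_right, real_inner_self_eq_norm_sq]
    ring
  have hhalf : 1 / (2 * r) = 1 / r / 2 := by field_simp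
  rw [hhalf] at hdesc ⊢
  linarith

theorem stmt_1 {n m : ℕ} (F : EuclideanSpace ℝ (Fin n) → ℝ)
    (G : EuclideanSpace ℝ (Fin m) → ℝ)
    (F' : EuclideanSpace ℝ (Fin n) → EuclideanSpace ℝ (Fin n))
    (G' : EuclideanSpace ℝ (Fin m) → EuclideanSpace ℝ (Fin m))
    (μF μG LF LG r s θ : ℝ)
    (A : EuclideanSpace ℝ (Fin n) →L[ℝ] EuclideanSpace ℝ (Fin m))
    (hFdiff : ∀ z, HasGradientAt F (F' z) z)
    (hGdiff : ∀ z, HasGradientAt G (G' z) z)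
    (hμF : 0 < μF) (hμG : 0 < μG)
    (hFsc : ∀ a b, F b ≥ F a + ⟪F' a, b - a⟫ + μF / 2 * ‖b - a‖ ^ 2)
    (hGsc : ∀ a b, G b ≥ G a + ⟪G' a, b - a⟫ + μG / 2 * ‖b - a‖ ^ 2)
    (hFsm : ∀ a b, ‖F' b - F' a‖ ≤ LF * ‖b - a‖)
    (hGsm : ∀ a b, ‖G' b - G' a‖ ≤ LG * ‖b - a‖)
    (hr0 : 0 < r) (hr : r ≤ 1 / LF) (hs0 : 0 < s) (hs : s ≤ 1 / LG)
    (hθ : θ = min (Real.sqrt (μF * r)) (Real.sqrt (μG * s)))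
    (L : EuclideanSpace ℝ (Fin n) → EuclideanSpace ℝ (Fin m) → ℝ)
    (hL : ∀ p q, L p q = F p + ⟪A p, q⟫ - G q)
    (xstar : EuclideanSpace ℝ (Fin n)) (ystar : EuclideanSpace ℝ (Fin m))
    (hsaddle : ∀ p q, L xstar q ≤ L xstar ystar ∧ L xstar ystar ≤ L p ystar)
    (x xbar : ℕ → EuclideanSpace ℝ (Fin n))
    (y ybar : ℕ → EuclideanSpace ℝ (Fin m))
    (hx1 : x 1 = x 0) (hy1 : y 1 = y 0)
    (hxbar : ∀ k, 1 ≤ k → xbar k = x k + ((1 - θ) / (1 + θ)) • (x k - x (k - 1)))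
    (hybar : ∀ k, 1 ≤ k → ybar k = y k + ((1 - θ) / (1 + θ)) • (y k - y (k - 1)))
    (hxupd : ∀ k, 1 ≤ k → x (k + 1) = xbar k - r •
      (F' (xbar k) + (ContinuousLinearMap.adjoint A) (y k + (1 / θ) • (y (k + 1) - y k))))
    (hyupd : ∀ k, 1 ≤ k → y (k + 1) = ybar k - s •
      (G' (ybar k) - A (x k + (1 / θ) • (x (k + 1) - x k))))
    : ∀ k : ℕ, 1 ≤ k →
      L (x (k + 1)) ystar - L xstar (y (k + 1)) ≤
        (1 - θ) * (L (x k) ystar - L xstar (y k))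
        - (1 / r) * ⟪x (k + 1) - xbar k, xbar k - θ • xstar - (1 - θ) • x k⟫
        - 1 / (2 * r) * ‖x (k + 1) - xbar k‖ ^ 2
        - μF * θ / 2 * ‖xbar k - xstar‖ ^ 2
        - (1 / s) * ⟪y (k + 1) - ybar k, ybar k - θ • ystar - (1 - θ) • y k⟫
        - 1 / (2 * s) * ‖y (k + 1) - ybar k‖ ^ 2
        - μG * θ / 2 * ‖ybar k - ystar‖ ^ 2 := by
  intro k hk
  have hθ0 : 0 < θ := by
    rw [hθ]
    exact lt_min (Real.sqrt_pos.2 (by positivity)) (Real.sqrt_pos.2 (by positivity))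
  have hF := inertial_gradient_step_le hFdiff hμF hFsc hFsm hr0 hr hθ0.le
    (hθ.trans_le (min_le_left _ _)) (hxupd k hk) xstar (x k)
  have hG := inertial_gradient_step_le hGdiff hμG hGsc hGsm hs0 hs hθ0.le
    (hθ.trans_le (min_le_right _ _)) ((hyupd k hk).trans (by rw [sub_eq_add_neg (G' _)]))
    ystar (y k)
  have hcoupling :
      ⟪A (x (k + 1)), ystar⟫ - ⟪A xstar, y (k + 1)⟫
        - (1 - θ) * (⟪A (x k), ystar⟫ - ⟪A xstar, y k⟫)
      = ⟪(ContinuousLinearMap.adjoint A) (y k + (1 / θ) • (y (k + 1) - y k)),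
          x (k + 1) - θ • xstar - (1 - θ) • x k⟫
        + ⟪-A (x k + (1 / θ) • (x (k + 1) - x k)),
          y (k + 1) - θ • ystar - (1 - θ) • y k⟫ := by
    rw [ContinuousLinearMap.adjoint_inner_left,
      real_inner_comm (A (x (k + 1) - θ • xstar - (1 - θ) • x k))]
    simp only [map_add, map_sub, map_smul, inner_add_left, inner_add_right, inner_sub_left,
      inner_sub_right, real_inner_smul_left, real_inner_smul_right, inner_neg_left]
    field_simp
    ring
  simp only [hL]
  linarith
end

section
/- Under Assumption 1 (F is μ_F-strongly convex and L_F-smooth, G is μ_G-strongly convex and L_G-smooth), let (x_k, y_k)_{k≥1} be iterates of the primal-dual scheme with step sizes r ≤ 1/L_F, s ≤ 1/L_G, θ = min{√(μ_F r), √(μ_G s)}, and x_1 = x_0, y_1 = y_0, and let (x*, y*) be the unique saddle point of L. Then for every k ≥ 1: L(x_k, y*) − L(x*, y_k) ≤ (1 − θ)^{k−1} · E_1, where E_1 = L(x_1, y*) − L(x*, y_1) + (θ²/(2r))‖x_1 − x*‖² + (θ²/(2s))‖y_1 − y*‖². -/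
open scoped RealInnerProductSpace

section

variable {E : Type*} [NormedAddCommGroup E] [InnerProductSpace ℝ E] [CompleteSpace E]

/-- The descent lemma: a function with `K`-Lipschitz gradient lies below its quadratic models. -/
theorem le_quadratic_of_lipschitz_gradient {f : E → ℝ} {f' : E → E} {K : ℝ}
    (hf : ∀ z, HasGradientAt f (f' z) z) (hK : ∀ a b, ‖f' b - f' a‖ ≤ K * ‖b - a‖) (a d : E) :
    f (a + d) ≤ f a + ⟪f' a, d⟫ + K / 2 * ‖d‖ ^ 2 := by
  have hline (t : ℝ) : HasDerivAt (fun t : ℝ => f (a + t • d)) ⟪f' (a + t • d), d⟫ t := by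
    have hl : HasDerivAt (fun t : ℝ => a + t • d) d t := by
      simpa using ((hasDerivAt_id t).smul_const d).const_add a
    exact (hf (a + t • d)).hasFDerivAt.comp_hasDerivAt t hl
  have hgap (t : ℝ) : HasDerivAt
      (fun t : ℝ => f (a + t • d) - (t * ⟪f' a, d⟫ + K / 2 * ‖d‖ ^ 2 * t ^ 2))
      (⟪f' (a + t • d), d⟫ - (⟪f' a, d⟫ + K * ‖d‖ ^ 2 * t)) t := by
    refine ((hline t).sub (((hasDerivAt_id t).mul_const ⟪f' a, d⟫).add
      ((hasDerivAt_pow 2 t).const_mul (K / 2 * ‖d‖ ^ 2)))).congr_deriv ?_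
    push_cast
    ring
  have hanti : AntitoneOn
      (fun t : ℝ => f (a + t • d) - (t * ⟪f' a, d⟫ + K / 2 * ‖d‖ ^ 2 * t ^ 2)) (Set.Ici 0) := by
    refine antitoneOn_of_deriv_nonpos (convex_Ici 0)
      (fun t _ => (hgap t).continuousAt.continuousWithinAt)
      (fun t _ => (hgap t).differentiableAt.differentiableWithinAt) fun t ht => ?_
    rw [interior_Ici, Set.mem_Ioi] at ht
    rw [(hgap t).deriv]
    have hcs := real_inner_le_norm (f' (a + t • d) - f' a) d
    have hlip := hK a (a + t • d)
    rw [add_sub_cancel_left, norm_smul, Real.norm_of_nonneg ht.le] at hlip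
    rw [inner_sub_left] at hcs
    nlinarith [mul_le_mul_of_nonneg_right hlip (norm_nonneg d)]
  have h := hanti (Set.mem_Ici.2 le_rfl) (Set.mem_Ici.2 zero_le_one) zero_le_one
  simp only [one_smul, zero_smul, add_zero] at h
  linarith

/-- One step of Nesterov's accelerated gradient method for the function `f + ⟪h, ·⟫`, with
extrapolated point `c`, contracts the Lyapunov function built from the auxiliary points `v`. -/
theorem accelerated_gradient_step_le {f : E → ℝ} {f' : E → E} {μ K r θ : ℝ}
    (hf : ∀ z, HasGradientAt f (f' z) z)
    (hsc : ∀ a b, f b ≥ f a + ⟪f' a, b - a⟫ + μ / 2 * ‖b - a‖ ^ 2)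
    (hK : ∀ a b, ‖f' b - f' a‖ ≤ K * ‖b - a‖)
    (hr : 0 < r) (hrK : r ≤ 1 / K) (hθ : 0 < θ) (hθ1 : θ ≤ 1) (hθμ : θ ^ 2 ≤ μ * r)
    {x c x' v v' : E} (h z : E)
    (hc : c = x + (θ / (1 + θ)) • (v - x))
    (hx' : x' = c - r • (f' c + h)) (hv' : v' = x + (1 / θ) • (x' - x)) :
    f x' - f z + θ * ⟪h, v' - z⟫ + θ ^ 2 / (2 * r) * ‖v' - z‖ ^ 2
      ≤ (1 - θ) * (f x - f z + θ ^ 2 / (2 * r) * ‖v - z‖ ^ 2) := by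
  have hθp : 1 + θ ≠ 0 := by positivity
  have hK0 : 0 < K := one_div_pos.1 (hr.trans_le hrK)
  obtain ⟨a, rfl⟩ : ∃ a, v = c + a := ⟨v - c, by abel⟩
  obtain ⟨b, rfl⟩ : ∃ b, z = c + b := ⟨z - c, by abel⟩
  obtain ⟨g, hg⟩ : ∃ g, g = f' c + h := ⟨_, rfl⟩
  have hh : h = g - f' c := by rw [hg]; abel
  have hx : x = c - θ • a := by
    have h1 : (1 + θ) • c = x + θ • (c + a) := by
      conv_lhs => rw [hc]
      match_scalars <;> field_simp
      ring
    have h2 : x = (1 + θ) • c - θ • (c + a) := by rw [h1]; abel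
    rw [h2]; module
  have hv : v' - (c + b) = (1 - θ) • a - b - (r / θ) • g := by
    rw [hv', hx', ← hg, hx]
    match_scalars <;> field_simp <;> ring
  clear hc hv'
  have hμ : θ ^ 2 / r ≤ μ := (div_le_iff₀ hr).2 hθμ
  have hKr : K ≤ 1 / r := (le_one_div hr hK0).1 hrK
  have hd := le_quadratic_of_lipschitz_gradient hf hK c (-(r • g))
  rw [← sub_eq_add_neg, hg, ← hx', ← hg] at hd
  have hsx := hsc c x
  have hsz := hsc c (c + b)
  rw [show x - c = -(θ • a) by rw [hx]; abel] at hsx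
  rw [add_sub_cancel_left] at hsz
  have hd' : f x' ≤ f c - r * ⟪f' c, g⟫ + r / 2 * ‖g‖ ^ 2 := by
    have : K / 2 * ‖-(r • g)‖ ^ 2 ≤ r / 2 * ‖g‖ ^ 2 := by
      rw [norm_neg, norm_smul, Real.norm_of_nonneg hr.le]
      calc K / 2 * (r * ‖g‖) ^ 2 ≤ (1 / r) / 2 * (r * ‖g‖) ^ 2 := by gcongr
        _ = r / 2 * ‖g‖ ^ 2 := by field_simp
    rw [inner_neg_right, real_inner_smul_right] at hd
    linarith
  have hsx' : f c - θ * ⟪f' c, a⟫ ≤ f x := by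
    have : 0 ≤ μ / 2 * ‖-(θ • a)‖ ^ 2 := by
      have : 0 ≤ μ := le_trans (by positivity) hμ
      positivity
    rw [inner_neg_right, real_inner_smul_right] at hsx
    linarith
  have hsz' : f c + ⟪f' c, b⟫ + θ ^ 2 / r / 2 * ‖b‖ ^ 2 ≤ f (c + b) := by
    refine le_trans ?_ hsz
    gcongr
  have hθ' : 0 ≤ 1 - θ := sub_nonneg.2 hθ1
  have hsq : 0 ≤ θ ^ 2 / (2 * r) * (θ * (1 - θ)) * ‖a‖ ^ 2 := by positivity
  have hexp : θ ^ 2 / (2 * r) * ‖(1 - θ) • a - b - (r / θ) • g‖ ^ 2 =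
      θ ^ 2 / (2 * r) * ((1 - θ) ^ 2 * ‖a‖ ^ 2 + ‖b‖ ^ 2 - 2 * (1 - θ) * ⟪a, b⟫)
        - θ * ((1 - θ) * ⟪g, a⟫ - ⟪g, b⟫) + r / 2 * ‖g‖ ^ 2 := by
    simp only [← real_inner_self_eq_norm_sq, inner_sub_left, inner_sub_right,
      real_inner_smul_left, real_inner_smul_right, real_inner_comm a b, real_inner_comm a g,
      real_inner_comm b g]
    field_simp
    ring
  have hlin : θ * ⟪h, (1 - θ) • a - b - (r / θ) • g⟫ =
      θ * ((1 - θ) * (⟪g, a⟫ - ⟪f' c, a⟫) - (⟪g, b⟫ - ⟪f' c, b⟫))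
        - r * (‖g‖ ^ 2 - ⟪f' c, g⟫) := by
    rw [hh]
    simp only [← real_inner_self_eq_norm_sq, inner_sub_left, inner_sub_right,
      real_inner_smul_right]
    field_simp
  have hab : ‖c + a - (c + b)‖ ^ 2 = ‖a‖ ^ 2 + ‖b‖ ^ 2 - 2 * ⟪a, b⟫ := by
    rw [add_sub_add_left_eq_sub, norm_sub_sq_real]
    ring
  rw [hv, hexp, hlin, hab]
  have h1 := mul_le_mul_of_nonneg_left hsx' hθ'
  have h2 := mul_le_mul_of_nonneg_left hsz' hθ.le
  have hhalf : θ ^ 2 / r / 2 = θ ^ 2 / (2 * r) := by field_simp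
  rw [hhalf] at h2
  linarith

/-- A strong convexity modulus of a smooth function is at most the smoothness constant. -/
theorem strong_convexity_le_smoothness [Nontrivial E] {f : E → ℝ} {f' : E → E} {μ K : ℝ}
    (hf : ∀ z, HasGradientAt f (f' z) z)
    (hsc : ∀ a b, f b ≥ f a + ⟪f' a, b - a⟫ + μ / 2 * ‖b - a‖ ^ 2)
    (hK : ∀ a b, ‖f' b - f' a‖ ≤ K * ‖b - a‖) : μ ≤ K := by
  obtain ⟨d, hd⟩ := exists_ne (0 : E)
  have h1 := le_quadratic_of_lipschitz_gradient hf hK 0 d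
  have h2 := hsc 0 d
  rw [zero_add] at h1
  rw [sub_zero] at h2
  have : 0 < ‖d‖ ^ 2 := by positivity
  nlinarith

end

theorem stmt_2 {n m : ℕ} (F : EuclideanSpace ℝ (Fin n) → ℝ)
    (G : EuclideanSpace ℝ (Fin m) → ℝ)
    (F' : EuclideanSpace ℝ (Fin n) → EuclideanSpace ℝ (Fin n))
    (G' : EuclideanSpace ℝ (Fin m) → EuclideanSpace ℝ (Fin m))
    (μF μG LF LG r s θ : ℝ)
    (A : EuclideanSpace ℝ (Fin n) →L[ℝ] EuclideanSpace ℝ (Fin m))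
    (hFdiff : ∀ z, HasGradientAt F (F' z) z)
    (hGdiff : ∀ z, HasGradientAt G (G' z) z)
    (hμF : 0 < μF) (hμG : 0 < μG)
    (hFsc : ∀ a b, F b ≥ F a + ⟪F' a, b - a⟫ + μF / 2 * ‖b - a‖ ^ 2)
    (hGsc : ∀ a b, G b ≥ G a + ⟪G' a, b - a⟫ + μG / 2 * ‖b - a‖ ^ 2)
    (hFsm : ∀ a b, ‖F' b - F' a‖ ≤ LF * ‖b - a‖)
    (hGsm : ∀ a b, ‖G' b - G' a‖ ≤ LG * ‖b - a‖)
    (hr0 : 0 < r) (hr : r ≤ 1 / LF) (hs0 : 0 < s) (hs : s ≤ 1 / LG)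
    (hθ : θ = min (Real.sqrt (μF * r)) (Real.sqrt (μG * s)))
    (L : EuclideanSpace ℝ (Fin n) → EuclideanSpace ℝ (Fin m) → ℝ)
    (hL : ∀ p q, L p q = F p + ⟪A p, q⟫ - G q)
    (xstar : EuclideanSpace ℝ (Fin n)) (ystar : EuclideanSpace ℝ (Fin m))
    (hsaddle : ∀ p q, L xstar q ≤ L xstar ystar ∧ L xstar ystar ≤ L p ystar)
    (x xbar : ℕ → EuclideanSpace ℝ (Fin n))
    (y ybar : ℕ → EuclideanSpace ℝ (Fin m))
    (hx1 : x 1 = x 0) (hy1 : y 1 = y 0)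
    (hxbar : ∀ k, 1 ≤ k → xbar k = x k + ((1 - θ) / (1 + θ)) • (x k - x (k - 1)))
    (hybar : ∀ k, 1 ≤ k → ybar k = y k + ((1 - θ) / (1 + θ)) • (y k - y (k - 1)))
    (hxupd : ∀ k, 1 ≤ k → x (k + 1) = xbar k - r •
      (F' (xbar k) + (ContinuousLinearMap.adjoint A) (y k + (1 / θ) • (y (k + 1) - y k))))
    (hyupd : ∀ k, 1 ≤ k → y (k + 1) = ybar k - s •
      (G' (ybar k) - A (x k + (1 / θ) • (x (k + 1) - x k))))
    (E1 : ℝ)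
    (hE1 : E1 = L (x 1) ystar - L xstar (y 1)
      + θ ^ 2 / (2 * r) * ‖x 1 - xstar‖ ^ 2 + θ ^ 2 / (2 * s) * ‖y 1 - ystar‖ ^ 2)
    : ∀ k : ℕ, 1 ≤ k →
      L (x k) ystar - L xstar (y k) ≤ (1 - θ) ^ (k - 1) * E1 := by
  have hθ0 : 0 < θ := by rw [hθ]; positivity
  have hθF : θ ^ 2 ≤ μF * r := by
    rw [← Real.sq_sqrt (show 0 ≤ μF * r by positivity)]
    gcongr
    exact hθ ▸ min_le_left _ _
  have hθG : θ ^ 2 ≤ μG * s := by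
    rw [← Real.sq_sqrt (show 0 ≤ μG * s by positivity)]
    gcongr
    exact hθ ▸ min_le_right _ _
  have hle {μ K t : ℝ} (hμK : μ ≤ K) (ht : 0 < t) (htK : t ≤ 1 / K) (h : θ ^ 2 ≤ μ * t) :
      θ ≤ 1 := by
    have hK : 0 < K := one_div_pos.1 (ht.trans_le htK)
    have : t * K ≤ 1 := (le_div_iff₀ hK).1 htK
    exact (sq_le_one_iff₀ hθ0.le).1 (by nlinarith)
  by_cases hθ1 : θ ≤ 1
  swap
  · have : Subsingleton (EuclideanSpace ℝ (Fin n)) := by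
      by_contra hn
      have := not_subsingleton_iff_nontrivial.1 hn
      exact hθ1 (hle (strong_convexity_le_smoothness hFdiff hFsc hFsm) hr0 hr hθF)
    have : Subsingleton (EuclideanSpace ℝ (Fin m)) := by
      by_contra hm
      have := not_subsingleton_iff_nontrivial.1 hm
      exact hθ1 (hle (strong_convexity_le_smoothness hGdiff hGsc hGsm) hs0 hs hθG)
    intro k _
    simp [hE1, Subsingleton.elim (x k) xstar, Subsingleton.elim (y k) ystar,
      Subsingleton.elim (x 1) xstar, Subsingleton.elim (y 1) ystar]
  have hθ' : 0 ≤ 1 - θ := sub_nonneg.2 hθ1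
  obtain ⟨v, hv⟩ : ∃ v : ℕ → EuclideanSpace ℝ (Fin n),
      ∀ k, v k = x (k - 1) + (1 / θ) • (x k - x (k - 1)) := ⟨_, fun _ => rfl⟩
  obtain ⟨w, hw⟩ : ∃ w : ℕ → EuclideanSpace ℝ (Fin m),
      ∀ k, w k = y (k - 1) + (1 / θ) • (y k - y (k - 1)) := ⟨_, fun _ => rfl⟩
  have key : ∀ k, L (x (k + 1)) ystar - L xstar (y (k + 1))
      + θ ^ 2 / (2 * r) * ‖v (k + 1) - xstar‖ ^ 2 + θ ^ 2 / (2 * s) * ‖w (k + 1) - ystar‖ ^ 2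
      ≤ (1 - θ) ^ k * E1 := by
    intro k
    induction k with
    | zero =>
      simp [hv, hw, hx1, hy1, hE1]
    | succ k ih =>
      have hk : 1 ≤ k + 1 := Nat.le_add_left 1 k
      have hvs : v (k + 1 + 1) = x (k + 1) + (1 / θ) • (x (k + 1 + 1) - x (k + 1)) := hv _
      have hws : w (k + 1 + 1) = y (k + 1) + (1 / θ) • (y (k + 1 + 1) - y (k + 1)) := hw _
      have hcx : xbar (k + 1) = x (k + 1) + (θ / (1 + θ)) • (v (k + 1) - x (k + 1)) := by
        rw [hxbar _ hk, hv]
        match_scalars <;> field_simp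
        ring
      have hcy : ybar (k + 1) = y (k + 1) + (θ / (1 + θ)) • (w (k + 1) - y (k + 1)) := by
        rw [hybar _ hk, hw]
        match_scalars <;> field_simp
        ring
      have hux := hxupd _ hk
      have huy := hyupd _ hk
      rw [← hws] at hux
      rw [← hvs, sub_eq_add_neg (G' _)] at huy
      have hFs := accelerated_gradient_step_le hFdiff hFsc hFsm hr0 hr hθ0 hθ1 hθF _ xstar
        hcx hux hvs
      have hGs := accelerated_gradient_step_le hGdiff hGsc hGsm hs0 hs hθ0 hθ1 hθG _ ystar
        hcy huy hws
      have hxe : x (k + 1 + 1) = (1 - θ) • x (k + 1) + θ • v (k + 1 + 1) := by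
        rw [hvs]
        match_scalars <;> field_simp
        ring
      have hye : y (k + 1 + 1) = (1 - θ) • y (k + 1) + θ • w (k + 1 + 1) := by
        rw [hws]
        match_scalars <;> field_simp
        ring
      have hAx : ⟪A (x (k + 1 + 1)), ystar⟫ =
          (1 - θ) * ⟪A (x (k + 1)), ystar⟫ + θ * ⟪A (v (k + 1 + 1)), ystar⟫ := by
        rw [hxe, map_add, map_smul, map_smul, inner_add_left, real_inner_smul_left,
          real_inner_smul_left]
      have hAy : ⟪A xstar, y (k + 1 + 1)⟫ =
          (1 - θ) * ⟪A xstar, y (k + 1)⟫ + θ * ⟪A xstar, w (k + 1 + 1)⟫ := by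
        rw [hye, inner_add_right, real_inner_smul_right, real_inner_smul_right]
      rw [ContinuousLinearMap.adjoint_inner_left, map_sub, inner_sub_right,
        real_inner_comm (A _), real_inner_comm (A _)] at hFs
      rw [inner_neg_left, inner_sub_right] at hGs
      have hstep := mul_le_mul_of_nonneg_left ih hθ'
      rw [pow_succ' (1 - θ)]
      simp only [hL] at hstep ⊢
      rw [hAx, hAy]
      linarith
  intro k hk
  obtain ⟨j, rfl⟩ := Nat.exists_eq_add_of_le' hk
  have h1 : 0 ≤ θ ^ 2 / (2 * r) * ‖v (j + 1) - xstar‖ ^ 2 := by positivity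
  have h2 : 0 ≤ θ ^ 2 / (2 * s) * ‖w (j + 1) - ystar‖ ^ 2 := by positivity
  rw [Nat.add_sub_cancel]
  linarith [key j]
end

section
/- Under Assumption 1 (F is μ_F-strongly convex and L_F-smooth, G is μ_G-strongly convex and L_G-smooth), let (x_k, y_k)_{k≥1} be iterates of the primal-dual scheme with r ≤ 1/L_F, s ≤ 1/L_G, θ = min{√(μ_F r), √(μ_G s)}, and (x*, y*) the unique saddle point of L. Define the energy E_k = L(x_k, y*) − L(x*, y_k) + (1/(2r))‖u_k‖² + (1/(2s))‖v_k‖², where u_k = θ(x_k − x*) + (1 − θ)(x_k − x_{k−1}) and v_k = θ(y_k − y*) + (1 − θ)(y_k − y_{k−1}). Then for every k ≥ 1: E_{k+1} ≤ (1 − θ) E_k. -/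
open scoped RealInnerProductSpace

section AcceleratedStep

variable {V : Type*} [NormedAddCommGroup V] [InnerProductSpace ℝ V]

/-- The descent lemma: a function with `K`-Lipschitz gradient lies below its quadratic model. -/
theorem le_quadratic_model_of_lipschitz_gradient [CompleteSpace V] {f : V → ℝ} {f' : V → V}
    {K : ℝ} (hf : ∀ z, HasGradientAt f (f' z) z)
    (hK : ∀ a b, ‖f' b - f' a‖ ≤ K * ‖b - a‖) (a b : V) :
    f b ≤ f a + ⟪f' a, b - a⟫ + K / 2 * ‖b - a‖ ^ 2 := by
  set d := b - a with hd
  have hder : ∀ t : ℝ, HasDerivAt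
      (fun t : ℝ => f (a + t • d) - t * ⟪f' a, d⟫ - K / 2 * ‖d‖ ^ 2 * t ^ 2)
      (⟪f' (a + t • d), d⟫ - ⟪f' a, d⟫ - K * ‖d‖ ^ 2 * t) t := by
    intro t
    have hline : HasDerivAt (fun t : ℝ => a + t • d) d t := by
      simpa using ((hasDerivAt_id t).smul_const d).const_add a
    have hcomp : HasDerivAt (fun t : ℝ => f (a + t • d)) ⟪f' (a + t • d), d⟫ t := by
      simpa [Function.comp_def] using
        (hf (a + t • d)).hasFDerivAt.comp_hasDerivAt t hline
    have hlin := (hasDerivAt_id t).mul_const ⟪f' a, d⟫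
    have hsq := (hasDerivAt_pow 2 t).const_mul (K / 2 * ‖d‖ ^ 2)
    refine ((hcomp.sub hlin).sub hsq).congr_deriv ?_
    push_cast
    ring
  have hanti := antitoneOn_of_deriv_nonpos (convex_Icc (0 : ℝ) 1)
    (fun t _ => (hder t).continuousAt.continuousWithinAt)
    (fun t _ => (hder t).differentiableAt.differentiableWithinAt) (by
      intro t ht
      rw [interior_Icc] at ht
      rw [(hder t).deriv, ← inner_sub_left]
      have hlip := hK a (a + t • d)
      rw [add_sub_cancel_left, norm_smul, Real.norm_eq_abs, abs_of_pos ht.1] at hlip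
      have hcs := real_inner_le_norm (f' (a + t • d) - f' a) d
      nlinarith [mul_le_mul_of_nonneg_right hlip (norm_nonneg d)])
  have h01 := hanti (Set.left_mem_Icc.2 zero_le_one) (Set.right_mem_Icc.2 zero_le_one) zero_le_one
  simp only [one_smul, zero_smul, add_zero, hd, add_sub_cancel] at h01
  rw [← hd] at h01
  linarith

/-- On a space with two distinct points, the strong convexity modulus is at most the Lipschitz
constant of the gradient. -/
theorem strong_convexity_modulus_le_lipschitz {f : V → ℝ} {f' : V → V} {μ K : ℝ}
    (hsc : ∀ a b, f b ≥ f a + ⟪f' a, b - a⟫ + μ / 2 * ‖b - a‖ ^ 2)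
    (hK : ∀ a b, ‖f' b - f' a‖ ≤ K * ‖b - a‖) {a b : V} (hab : a ≠ b) : μ ≤ K := by
  have hpos : 0 < ‖b - a‖ := norm_pos_iff.2 (sub_ne_zero.2 hab.symm)
  have h1 := hsc a b
  have h2 := hsc b a
  rw [← neg_sub b a, inner_neg_right, norm_neg] at h2
  have hcs := real_inner_le_norm (f' b - f' a) (b - a)
  rw [inner_sub_left] at hcs
  have h3 := mul_le_mul_of_nonneg_right (hK a b) hpos.le
  refine le_of_mul_le_mul_right ?_ (pow_pos hpos 2)
  linarith [sq ‖b - a‖]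

theorem subsingleton_of_one_lt_sqrt {f : V → ℝ} {f' : V → V} {μ K r θ : ℝ}
    (hsc : ∀ a b, f b ≥ f a + ⟪f' a, b - a⟫ + μ / 2 * ‖b - a‖ ^ 2)
    (hK : ∀ a b, ‖f' b - f' a‖ ≤ K * ‖b - a‖)
    (hr0 : 0 < r) (hr : r ≤ 1 / K) (hθ : θ ≤ Real.sqrt (μ * r)) (h1 : 1 < θ) :
    Subsingleton V := by
  refine ⟨fun a b => by_contra fun hab => ?_⟩
  have hμK := strong_convexity_modulus_le_lipschitz hsc hK hab
  have hK0 : 0 < K := one_div_pos.1 (hr0.trans_le hr)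
  rw [le_div_iff₀ hK0] at hr
  have : Real.sqrt (μ * r) ≤ 1 := Real.sqrt_le_one.2 (by nlinarith)
  linarith

/-- The quadratic estimate behind the choice `(1 - θ) / (1 + θ)` of the extrapolation weight. -/
theorem norm_sq_extrapolation_le {θ : ℝ} (h0 : 0 < θ) (h1 : θ ≤ 1) (a d : V) :
    ‖θ • a + ((1 - θ) / (1 + θ)) • d‖ ^ 2 ≤
      (1 - θ) * ‖θ • a + (1 - θ) • d‖ ^ 2 + (1 - θ) * θ ^ 2 * ‖((1 - θ) / (1 + θ)) • d‖ ^ 2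
        + θ ^ 3 * ‖a + ((1 - θ) / (1 + θ)) • d‖ ^ 2 := by
  obtain ⟨β, hβ⟩ : ∃ β, β = (1 - θ) / (1 + θ) := ⟨_, rfl⟩
  have hβ' : β * (1 + θ) = 1 - θ := by rw [hβ]; field_simp
  have hβ0 : 0 ≤ β := hβ ▸ div_nonneg (by linarith) (by linarith)
  rw [← hβ]
  simp only [norm_add_sq_real, norm_smul, mul_pow, Real.norm_eq_abs, sq_abs,
    real_inner_smul_left, real_inner_smul_right]
  have hgap : 0 ≤ θ * β * (1 - θ) ^ 2 * ‖d‖ ^ 2 := by positivity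
  linear_combination hgap + (2 * θ * (1 - θ) * ⟪a, d⟫ + ((1 - θ) ^ 2 + β * (1 - θ)) * ‖d‖ ^ 2) * hβ'

/-- One accelerated gradient step along `f' + c` perturbed by `q`: the energy contracts by
`1 - θ`, up to the work of the perturbation. -/
theorem perturbed_accelerated_step_energy_le [CompleteSpace V] {f : V → ℝ} {f' : V → V}
    {μ K r θ : ℝ} (hf : ∀ z, HasGradientAt f (f' z) z)
    (hsc : ∀ a b, f b ≥ f a + ⟪f' a, b - a⟫ + μ / 2 * ‖b - a‖ ^ 2)
    (hK : ∀ a b, ‖f' b - f' a‖ ≤ K * ‖b - a‖)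
    (hr0 : 0 < r) (hr : r ≤ 1 / K) (h0 : 0 < θ) (h1 : θ ≤ 1) (hθμ : θ ^ 2 ≤ μ * r)
    {p x w z xs c q : V} (hw : w = x + ((1 - θ) / (1 + θ)) • (x - p))
    (hz : z = w - r • (f' w + c + q)) :
    f z - f xs + ⟪c, z - xs⟫ + 1 / (2 * r) * ‖θ • (z - xs) + (1 - θ) • (z - x)‖ ^ 2 ≤
      (1 - θ) * (f x - f xs + ⟪c, x - xs⟫
        + 1 / (2 * r) * ‖θ • (x - xs) + (1 - θ) • (x - p)‖ ^ 2)
      - ⟪q, θ • (z - xs) + (1 - θ) • (z - x)⟫ := by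
  set U := θ • (z - xs) + (1 - θ) • (z - x) with hU
  have hK0 : 0 < K := one_div_pos.1 (hr0.trans_le hr)
  have hKr : K ≤ 1 / r := by rwa [le_one_div hK0 hr0]
  have hdesc := le_quadratic_model_of_lipschitz_gradient hf hK w z
  have hconv := mul_le_mul_of_nonneg_left (hsc w x) (sub_nonneg.2 h1)
  have hconvs := mul_le_mul_of_nonneg_left (hsc w xs) h0.le
  have hf'U : ⟪f' w, U⟫ = ⟪f' w, z - w⟫ - (1 - θ) * ⟪f' w, x - w⟫ - θ * ⟪f' w, xs - w⟫ := by
    rw [← real_inner_smul_right, ← real_inner_smul_right, ← inner_sub_right, ← inner_sub_right]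
    congr 1
    rw [hU]
    module
  have hcU : ⟪c, U⟫ = ⟪c, z - xs⟫ - (1 - θ) * ⟪c, x - xs⟫ := by
    rw [← real_inner_smul_right, ← inner_sub_right]
    congr 1
    rw [hU]
    module
  have hstep : ⟪w - z, U⟫ = r * (⟪f' w, U⟫ + ⟪c, U⟫ + ⟪q, U⟫) := by
    rw [hz, sub_sub_cancel, real_inner_smul_left, inner_add_left, inner_add_left]
  have hquad := norm_sq_extrapolation_le h0 h1 (x - xs) (x - p)
  have e1 : θ • (x - xs) + ((1 - θ) / (1 + θ)) • (x - p) = U + (w - z) := by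
    rw [hU, hw]
    module
  have e2 : ((1 - θ) / (1 + θ)) • (x - p) = -(x - w) := by
    rw [hw]
    module
  have e3 : x - xs + ((1 - θ) / (1 + θ)) • (x - p) = -(xs - w) := by
    rw [hw]
    module
  rw [e1, e3, e2, norm_neg, norm_neg, norm_add_sq_real, real_inner_comm, hstep,
    norm_sub_rev w z] at hquad
  have hm1 := mul_le_mul_of_nonneg_right hθμ
    (mul_nonneg (sub_nonneg.2 h1) (sq_nonneg ‖x - w‖))
  have hm2 := mul_le_mul_of_nonneg_right hθμ (mul_nonneg h0.le (sq_nonneg ‖xs - w‖))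
  have hm3 := mul_le_mul_of_nonneg_right hKr (sq_nonneg ‖z - w‖)
  have hscaled : r * (f z - f xs + ⟪c, z - xs⟫) + 1 / 2 * ‖U‖ ^ 2 ≤
      r * ((1 - θ) * (f x - f xs + ⟪c, x - xs⟫) - ⟪q, U⟫)
        + 1 / 2 * ((1 - θ) * ‖θ • (x - xs) + (1 - θ) • (x - p)‖ ^ 2) := by
    have hsum : f z - f xs + ⟪c, z - xs⟫ ≤ (1 - θ) * (f x - f xs + ⟪c, x - xs⟫)
        + (⟪f' w, U⟫ + ⟪c, U⟫) + 1 / r * ‖z - w‖ ^ 2 / 2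
        - (1 - θ) * (μ / 2 * ‖x - w‖ ^ 2) - θ * (μ / 2 * ‖xs - w‖ ^ 2) := by
      linarith
    have hmul := mul_le_mul_of_nonneg_left hsum hr0.le
    have hrr : r * (1 / r * ‖z - w‖ ^ 2 / 2) = ‖z - w‖ ^ 2 / 2 := by field_simp
    linarith
  have hdiv := mul_le_mul_of_nonneg_left hscaled (one_div_pos.2 hr0).le
  have hr' : r ≠ 0 := hr0.ne'
  refine le_of_eq_of_le ?_ (hdiv.trans_eq ?_)
  · field_simp
  · field_simp
    ring

end AcceleratedStep

theorem stmt_4 {n m : ℕ} (F : EuclideanSpace ℝ (Fin n) → ℝ)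
    (G : EuclideanSpace ℝ (Fin m) → ℝ)
    (F' : EuclideanSpace ℝ (Fin n) → EuclideanSpace ℝ (Fin n))
    (G' : EuclideanSpace ℝ (Fin m) → EuclideanSpace ℝ (Fin m))
    (μF μG LF LG r s θ : ℝ)
    (A : EuclideanSpace ℝ (Fin n) →L[ℝ] EuclideanSpace ℝ (Fin m))
    (hFdiff : ∀ z, HasGradientAt F (F' z) z)
    (hGdiff : ∀ z, HasGradientAt G (G' z) z)
    (hμF : 0 < μF) (hμG : 0 < μG)
    (hFsc : ∀ a b, F b ≥ F a + ⟪F' a, b - a⟫ + μF / 2 * ‖b - a‖ ^ 2)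
    (hGsc : ∀ a b, G b ≥ G a + ⟪G' a, b - a⟫ + μG / 2 * ‖b - a‖ ^ 2)
    (hFsm : ∀ a b, ‖F' b - F' a‖ ≤ LF * ‖b - a‖)
    (hGsm : ∀ a b, ‖G' b - G' a‖ ≤ LG * ‖b - a‖)
    (hr0 : 0 < r) (hr : r ≤ 1 / LF) (hs0 : 0 < s) (hs : s ≤ 1 / LG)
    (hθ : θ = min (Real.sqrt (μF * r)) (Real.sqrt (μG * s)))
    (L : EuclideanSpace ℝ (Fin n) → EuclideanSpace ℝ (Fin m) → ℝ)
    (hL : ∀ p q, L p q = F p + ⟪A p, q⟫ - G q)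
    (xstar : EuclideanSpace ℝ (Fin n)) (ystar : EuclideanSpace ℝ (Fin m))
    (hsaddle : ∀ p q, L xstar q ≤ L xstar ystar ∧ L xstar ystar ≤ L p ystar)
    (x xbar : ℕ → EuclideanSpace ℝ (Fin n))
    (y ybar : ℕ → EuclideanSpace ℝ (Fin m))
    (hx1 : x 1 = x 0) (hy1 : y 1 = y 0)
    (hxbar : ∀ k, 1 ≤ k → xbar k = x k + ((1 - θ) / (1 + θ)) • (x k - x (k - 1)))
    (hybar : ∀ k, 1 ≤ k → ybar k = y k + ((1 - θ) / (1 + θ)) • (y k - y (k - 1)))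
    (hxupd : ∀ k, 1 ≤ k → x (k + 1) = xbar k - r •
      (F' (xbar k) + (ContinuousLinearMap.adjoint A) (y k + (1 / θ) • (y (k + 1) - y k))))
    (hyupd : ∀ k, 1 ≤ k → y (k + 1) = ybar k - s •
      (G' (ybar k) - A (x k + (1 / θ) • (x (k + 1) - x k))))
    (u : ℕ → EuclideanSpace ℝ (Fin n)) (v : ℕ → EuclideanSpace ℝ (Fin m))
    (hu : ∀ k, u k = θ • (x k - xstar) + (1 - θ) • (x k - x (k - 1)))
    (hv : ∀ k, v k = θ • (y k - ystar) + (1 - θ) • (y k - y (k - 1)))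
    (E : ℕ → ℝ)
    (hE : ∀ k, E k = L (x k) ystar - L xstar (y k)
      + 1 / (2 * r) * ‖u k‖ ^ 2 + 1 / (2 * s) * ‖v k‖ ^ 2)
    : ∀ k : ℕ, 1 ≤ k → E (k + 1) ≤ (1 - θ) * E k := by
  intro k hk
  have hθ0 : 0 < θ := hθ ▸ lt_min (Real.sqrt_pos.2 (mul_pos hμF hr0))
    (Real.sqrt_pos.2 (mul_pos hμG hs0))
  have hθF : θ ≤ Real.sqrt (μF * r) := hθ ▸ min_le_left _ _
  have hθG : θ ≤ Real.sqrt (μG * s) := hθ ▸ min_le_right _ _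
  rcases lt_or_ge 1 θ with hθ1 | hθ1
  · have := subsingleton_of_one_lt_sqrt hFsc hFsm hr0 hr hθF hθ1
    have := subsingleton_of_one_lt_sqrt hGsc hGsm hs0 hs hθG hθ1
    have hE0 : ∀ j, E j = 0 := fun j => by
      rw [hE, Subsingleton.elim (x j) xstar, Subsingleton.elim (y j) ystar,
        Subsingleton.elim (u j) 0, Subsingleton.elim (v j) 0]
      simp
    simp [hE0]
  have hu' := hu (k + 1)
  have hv' := hv (k + 1)
  rw [Nat.add_sub_cancel] at hu' hv'
  have hyv : y k + (1 / θ) • (y (k + 1) - y k) = ystar + (1 / θ) • v (k + 1) := by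
    rw [hv']
    match_scalars <;> field_simp <;> ring
  have hxu : x k + (1 / θ) • (x (k + 1) - x k) = xstar + (1 / θ) • u (k + 1) := by
    rw [hu']
    match_scalars <;> field_simp <;> ring
  have hF := perturbed_accelerated_step_energy_le (z := x (k + 1)) (xs := xstar)
    (c := A.adjoint ystar) (q := A.adjoint ((1 / θ) • v (k + 1)))
    hFdiff hFsc hFsm hr0 hr hθ0 hθ1
    ((Real.le_sqrt hθ0.le (mul_pos hμF hr0).le).1 hθF) (hxbar k hk)
    (by rw [hxupd k hk, hyv, map_add, add_assoc])
  have hG := perturbed_accelerated_step_energy_le (z := y (k + 1)) (xs := ystar)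
    (c := -A xstar) (q := -A ((1 / θ) • u (k + 1)))
    hGdiff hGsc hGsm hs0 hs hθ0 hθ1
    ((Real.le_sqrt hθ0.le (mul_pos hμG hs0).le).1 hθG) (hybar k hk)
    (by rw [hyupd k hk, hxu, map_add, sub_eq_add_neg (G' (ybar k)), neg_add, add_assoc])
  rw [← hu', ← hu k] at hF
  rw [← hv', ← hv k] at hG
  simp only [ContinuousLinearMap.adjoint_inner_left, map_smul, inner_sub_right,
    inner_neg_left, real_inner_smul_left] at hF hG
  rw [hE, hE, hL, hL, hL, hL]
  simp only [real_inner_comm _ ystar, real_inner_comm _ (v (k + 1))] at hF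
  linarith
end

section
/- Let θ ∈ (0, 1], x*, x_{k−1}, x_k ∈ ℝ^n, set x̄_k = x_k + ((1 − θ)/(1 + θ))(x_k − x_{k−1}) and u_k = θ(x_k − x*) + (1 − θ)(x_k − x_{k−1}). Then ‖x̄_k − θx* − (1 − θ)x_k‖² ≤ θ³ ‖x̄_k − x*‖² + (1 − θ)‖u_k‖². -/
/-- Convexity of the squared norm along a segment. -/
theorem norm_sq_smul_add_smul_le {E : Type*} [SeminormedAddCommGroup E] [NormedSpace ℝ E]
    {t : ℝ} (ht0 : 0 ≤ t) (ht1 : t ≤ 1) (v w : E) :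
    ‖t • v + (1 - t) • w‖ ^ 2 ≤ t * ‖v‖ ^ 2 + (1 - t) * ‖w‖ ^ 2 := by
  have hs : 0 ≤ 1 - t := sub_nonneg.2 ht1
  have h : ‖t • v + (1 - t) • w‖ ≤ t * ‖v‖ + (1 - t) * ‖w‖ := by
    refine (norm_add_le _ _).trans_eq ?_
    rw [norm_smul_of_nonneg ht0, norm_smul_of_nonneg hs]
  calc ‖t • v + (1 - t) • w‖ ^ 2 ≤ (t * ‖v‖ + (1 - t) * ‖w‖) ^ 2 := by gcongr
    _ ≤ t * ‖v‖ ^ 2 + (1 - t) * ‖w‖ ^ 2 := by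
      nlinarith [mul_nonneg (mul_nonneg ht0 hs) (sq_nonneg (‖v‖ - ‖w‖))]

theorem stmt_5 {n : ℕ} (θ : ℝ) (hθ0 : 0 < θ) (hθ1 : θ ≤ 1)
    (xstar xkm xk xbar uk : EuclideanSpace ℝ (Fin n))
    (hxbar : xbar = xk + ((1 - θ) / (1 + θ)) • (xk - xkm))
    (huk : uk = θ • (xk - xstar) + (1 - θ) • (xk - xkm)) :
    ‖xbar - θ • xstar - (1 - θ) • xk‖ ^ 2 ≤
      θ ^ 3 * ‖xbar - xstar‖ ^ 2 + (1 - θ) * ‖uk‖ ^ 2 := by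
  have hcomb : xbar - θ • xstar - (1 - θ) • xk
      = θ • (θ • (xbar - xstar)) + (1 - θ) • uk := by
    have hne : 1 + θ ≠ 0 := by positivity
    rw [hxbar, huk]
    match_scalars <;> field_simp <;> ring
  have h := norm_sq_smul_add_smul_le hθ0.le hθ1 (θ • (xbar - xstar)) uk
  rw [← hcomb, norm_smul_of_nonneg hθ0.le] at h
  linarith
end

section
/- Let F : ℝ^n → ℝ be differentiable, μ_F-strongly convex and L_F-smooth, let r ≤ 1/L_F and θ ∈ (0, 1]. Suppose x_{k+1} = x̄_k − r(∇F(x̄_k) + w) for some vectors x̄_k, x_k, x*, w ∈ ℝ^n. Then F(x_{k+1}) − F(x*) − (1 − θ)(F(x_k) − F(x*)) ≤ −(1/r)⟨x_{k+1} − x̄_k, x̄_k − θx* − (1 − θ)x_k⟩ − ⟨x_{k+1} − x_k + θ(x_k − x*), w⟩ − (1/(2r))‖x_{k+1} − x̄_k‖² − (μ_F θ/2)‖x̄_k − x*‖² − (μ_F(1 − θ)/2)‖x̄_k − x_k‖². -/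
open scoped RealInnerProductSpace

/-- The descent lemma: a function whose gradient is `L`-Lipschitz lies below its quadratic
upper model. -/
theorem le_add_inner_add_of_gradient_lipschitz {E : Type*} [NormedAddCommGroup E]
    [InnerProductSpace ℝ E] [CompleteSpace E] {F : E → ℝ} {F' : E → E} {L : ℝ}
    (hF : ∀ x, HasGradientAt F (F' x) x) (hL : ∀ x y, ‖F' y - F' x‖ ≤ L * ‖y - x‖) (x d : E) :
    F (x + d) ≤ F x + ⟪F' x, d⟫ + L / 2 * ‖d‖ ^ 2 := by
  have hderiv (t : ℝ) :
      HasDerivAt (fun t : ℝ => F (x + t • d) - t * ⟪F' x, d⟫ - L / 2 * ‖d‖ ^ 2 * t ^ 2)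
        (⟪F' (x + t • d), d⟫ - ⟪F' x, d⟫ - L * ‖d‖ ^ 2 * t) t := by
    have hline : HasDerivAt (fun t : ℝ => x + t • d) d t := by
      simpa using ((hasDerivAt_id t).smul_const d).const_add x
    have hcomp := (hF (x + t • d)).hasFDerivAt.comp_hasDerivAt t hline
    have hlin := (hasDerivAt_id t).mul_const ⟪F' x, d⟫
    have hquad := (hasDerivAt_pow 2 t).const_mul (L / 2 * ‖d‖ ^ 2)
    refine ((hcomp.sub hlin).sub hquad).congr_deriv ?_
    simp only [InnerProductSpace.toDual_apply_apply]
    push_cast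
    ring
  have hanti : AntitoneOn
      (fun t : ℝ => F (x + t • d) - t * ⟪F' x, d⟫ - L / 2 * ‖d‖ ^ 2 * t ^ 2) (Set.Icc 0 1) := by
    refine antitoneOn_of_hasDerivWithinAt_nonpos (convex_Icc 0 1)
      (fun t _ => (hderiv t).continuousAt.continuousWithinAt)
      (fun t _ => (hderiv t).hasDerivWithinAt) fun t ht => ?_
    rw [interior_Icc] at ht
    have hnorm : ‖F' (x + t • d) - F' x‖ ≤ L * (t * ‖d‖) := by
      simpa [norm_smul, abs_of_pos ht.1] using hL x (x + t • d)
    rw [← inner_sub_left]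
    nlinarith [real_inner_le_norm (F' (x + t • d) - F' x) d,
      mul_le_mul_of_nonneg_right hnorm (norm_nonneg d)]
  have h := hanti (Set.left_mem_Icc.2 zero_le_one) (Set.right_mem_Icc.2 zero_le_one) zero_le_one
  simp only [one_smul, zero_smul, add_zero] at h
  linarith

theorem stmt_6 {n : ℕ} (F : EuclideanSpace ℝ (Fin n) → ℝ)
    (F' : EuclideanSpace ℝ (Fin n) → EuclideanSpace ℝ (Fin n))
    (μF LF r θ : ℝ)
    (hdiff : ∀ x, HasGradientAt F (F' x) x)
    (hsc : ∀ x y, F y ≥ F x + ⟪F' x, y - x⟫ + μF / 2 * ‖y - x‖ ^ 2)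
    (hsm : ∀ x y, ‖F' y - F' x‖ ≤ LF * ‖y - x‖)
    (hr0 : 0 < r) (hr : r ≤ 1 / LF) (hθ0 : 0 < θ) (hθ1 : θ ≤ 1)
    (xbar xk xstar w xk1 : EuclideanSpace ℝ (Fin n))
    (hupd : xk1 = xbar - r • (F' xbar + w)) :
    F xk1 - F xstar - (1 - θ) * (F xk - F xstar) ≤
      -(1 / r) * ⟪xk1 - xbar, xbar - θ • xstar - (1 - θ) • xk⟫
      - ⟪xk1 - xk + θ • (xk - xstar), w⟫
      - 1 / (2 * r) * ‖xk1 - xbar‖ ^ 2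
      - μF * θ / 2 * ‖xbar - xstar‖ ^ 2
      - μF * (1 - θ) / 2 * ‖xbar - xk‖ ^ 2 := by
  have hLF : 0 < LF := one_div_pos.1 (hr0.trans_le hr)
  have hL : LF / 2 ≤ 1 / (2 * r) := by
    rw [div_le_div_iff₀ two_pos (by positivity)]
    nlinarith [(le_div_iff₀ hLF).1 hr]
  have hdesc := le_add_inner_add_of_gradient_lipschitz hdiff hsm xbar (xk1 - xbar)
  rw [add_sub_cancel] at hdesc
  have hquad := mul_le_mul_of_nonneg_right hL (sq_nonneg ‖xk1 - xbar‖)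
  have hstar := mul_le_mul_of_nonneg_left (hsc xbar xstar) hθ0.le
  have hk := mul_le_mul_of_nonneg_left (hsc xbar xk) (sub_nonneg.2 hθ1)
  rw [norm_sub_rev xstar] at hstar
  rw [norm_sub_rev xk] at hk
  have hgrad : F' xbar = -(1 / r) • (xk1 - xbar) - w := by
    rw [hupd, sub_sub_cancel_left, smul_neg, neg_smul, neg_neg, smul_smul,
      one_div_mul_cancel hr0.ne', one_smul, add_sub_cancel_right]
  have hinner : ⟪F' xbar, xk1 - xbar⟫ - θ * ⟪F' xbar, xstar - xbar⟫
        - (1 - θ) * ⟪F' xbar, xk - xbar⟫ =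
      -(1 / r) * ⟪xk1 - xbar, xbar - θ • xstar - (1 - θ) • xk⟫
        - ⟪xk1 - xk + θ • (xk - xstar), w⟫ - 1 / r * ‖xk1 - xbar‖ ^ 2 := by
    have hpoint : xk1 - xk + θ • (xk - xstar) =
        (xk1 - xbar) + (xbar - θ • xstar - (1 - θ) • xk) := by module
    have hcomb : ⟪F' xbar, xk1 - xbar⟫ - θ * ⟪F' xbar, xstar - xbar⟫
          - (1 - θ) * ⟪F' xbar, xk - xbar⟫ =
        ⟪F' xbar, (xk1 - xbar) + (xbar - θ • xstar - (1 - θ) • xk)⟫ := by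
      rw [← real_inner_smul_right, ← real_inner_smul_right, ← inner_sub_right, ← inner_sub_right]
      congr 1
      module
    rw [hcomb, hpoint, hgrad, inner_sub_left, real_inner_smul_left, inner_add_right,
      real_inner_self_eq_norm_sq, real_inner_comm w]
    ring
  have hhalf : 1 / r * ‖xk1 - xbar‖ ^ 2 = 2 * (1 / (2 * r) * ‖xk1 - xbar‖ ^ 2) := by
    field_simp
  linarith
end

section
/- Let F : ℝ^n → ℝ be differentiable and μ_F-strongly convex with μ_F > 0, G : ℝ^m → ℝ be differentiable and μ_G-strongly convex with μ_G > 0, ∇F and ∇G continuous, and A a real m×n matrix. Then there exists exactly one pair (x*, y*) ∈ ℝ^n × ℝ^m satisfying ∇F(x*) + Aᵀy* = 0 and ∇G(y*) − Ax* = 0; equivalently, the saddle point problem min_x max_y L(x, y) = F(x) + ⟨Ax, y⟩ − G(y) admits a unique saddle point. -/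
open scoped RealInnerProductSpace

section StrongConvexity

variable {E : Type*} [NormedAddCommGroup E] [InnerProductSpace ℝ E]

theorem hasGradientAt_inner_right [CompleteSpace E] (v x : E) :
    HasGradientAt (fun y => ⟪v, y⟫) v x :=
  ((InnerProductSpace.toDual ℝ E) v).hasFDerivAt

theorem HasGradientAt.eq_zero_of_forall_le [CompleteSpace E] {H : E → ℝ} {g x : E}
    (hH : HasGradientAt H g x) (hmin : ∀ y, H x ≤ H y) : g = 0 := by
  have hloc : IsLocalMin H x := Filter.Eventually.of_forall hmin
  have h := hloc.hasFDerivAt_eq_zero hH.hasFDerivAt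
  simpa using h

theorem strongly_monotone_of_strongly_convex {H : E → ℝ} {H' : E → E} {μ : ℝ}
    (hsc : ∀ x y, H y ≥ H x + ⟪H' x, y - x⟫ + μ / 2 * ‖y - x‖ ^ 2) (x y : E) :
    μ * ‖y - x‖ ^ 2 ≤ ⟪H' y - H' x, y - x⟫ := by
  have h₁ := hsc x y
  have h₂ := hsc y x
  rw [← neg_sub y x, inner_neg_right, norm_neg] at h₂
  rw [inner_sub_left]
  linarith

theorem tendsto_cocompact_atTop_of_strongly_convex [ProperSpace E] {H : E → ℝ} {g x : E}
    {μ : ℝ} (hμ : 0 < μ)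
    (hsc : ∀ y, H y ≥ H x + ⟪g, y - x⟫ + μ / 2 * ‖y - x‖ ^ 2) :
    Filter.Tendsto H (Filter.cocompact E) Filter.atTop := by
  have hnorm : Filter.Tendsto (fun y => ‖y - x‖) (Filter.cocompact E) Filter.atTop := by
    simpa only [dist_eq_norm] using tendsto_dist_right_cocompact_atTop x
  have hlin : Filter.Tendsto (fun y => -‖g‖ + μ / 2 * ‖y - x‖)
      (Filter.cocompact E) Filter.atTop :=
    Filter.tendsto_atTop_add_const_left _ _ (hnorm.const_mul_atTop (half_pos hμ))
  refine Filter.tendsto_atTop_mono (fun y => ?_)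
    (Filter.tendsto_atTop_add_const_left _ (H x) (hnorm.atTop_mul_atTop₀ hlin))
  have h := neg_le_of_abs_le (abs_real_inner_le_norm g (y - x))
  nlinarith [hsc y]

theorem exists_gradient_eq_zero_of_strongly_convex [ProperSpace E]
    {H : E → ℝ} {H' : E → E} {μ : ℝ} (hμ : 0 < μ) (hdiff : ∀ x, HasGradientAt H (H' x) x)
    (hsc : ∀ x y, H y ≥ H x + ⟪H' x, y - x⟫ + μ / 2 * ‖y - x‖ ^ 2) :
    ∃ x, H' x = 0 := by
  have hcont : Continuous H :=
    continuous_iff_continuousAt.2 fun x => (hdiff x).hasFDerivAt.continuousAt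
  obtain ⟨x, hx⟩ :=
    hcont.exists_forall_le (tendsto_cocompact_atTop_of_strongly_convex hμ (hsc 0))
  exact ⟨x, (hdiff x).eq_zero_of_forall_le hx⟩

theorem exists_gradient_eq_of_strongly_convex [ProperSpace E]
    {H : E → ℝ} {H' : E → E} {μ : ℝ} (hμ : 0 < μ) (hdiff : ∀ x, HasGradientAt H (H' x) x)
    (hsc : ∀ x y, H y ≥ H x + ⟪H' x, y - x⟫ + μ / 2 * ‖y - x‖ ^ 2) (z : E) :
    ∃ x, H' x = z := by
  obtain ⟨x, hx⟩ := exists_gradient_eq_zero_of_strongly_convex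
    (H := fun y => H y - ⟪z, y⟫) (H' := fun y => H' y - z) hμ
    (fun x => by
      have h := (hdiff x).hasFDerivAt.sub (hasGradientAt_inner_right z x).hasFDerivAt
      rw [← map_sub] at h
      exact h)
    (fun x y => by
      have h := hsc x y
      simp only [inner_sub_left, inner_sub_right] at h ⊢
      linarith)
  exact ⟨x, sub_eq_zero.1 hx⟩

/-- The convex conjugate of `H`, expressed through a right inverse `s` of its gradient. -/
def conjugateAlong (H : E → ℝ) (s : E → E) (z : E) : ℝ := ⟪z, s z⟫ - H (s z)

theorem conjugateAlong_ge {H : E → ℝ} {H' s : E → E} {μ : ℝ} (hμ : 0 ≤ μ)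
    (hsc : ∀ x y, H y ≥ H x + ⟪H' x, y - x⟫ + μ / 2 * ‖y - x‖ ^ 2)
    (hs : ∀ z, H' (s z) = z) (z w : E) :
    conjugateAlong H s z + ⟪s z, w - z⟫ ≤ conjugateAlong H s w := by
  have h := hsc (s w) (s z)
  have hsq : 0 ≤ μ / 2 * ‖s z - s w‖ ^ 2 := by positivity
  rw [hs, inner_sub_right] at h
  rw [conjugateAlong, conjugateAlong, inner_sub_right, real_inner_comm w (s z),
    real_inner_comm z (s z)]
  linarith

theorem hasGradientAt_conjugateAlong [CompleteSpace E] {H : E → ℝ} {H' s : E → E} {μ : ℝ}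
    (hμ : 0 < μ) (hsc : ∀ x y, H y ≥ H x + ⟪H' x, y - x⟫ + μ / 2 * ‖y - x‖ ^ 2)
    (hs : ∀ z, H' (s z) = z) (z : E) :
    HasGradientAt (conjugateAlong H s) (s z) z := by
  have hlip (w : E) : ‖s w - s z‖ ≤ μ⁻¹ * ‖w - z‖ := by
    have h := strongly_monotone_of_strongly_convex hsc (s z) (s w)
    rw [hs, hs] at h
    have h' := h.trans (real_inner_le_norm _ _)
    rw [inv_mul_eq_div, le_div_iff₀ hμ]
    rcases (norm_nonneg (s w - s z)).eq_or_lt with h0 | h0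
    · rw [← h0, zero_mul]
      exact norm_nonneg _
    · nlinarith
  rw [hasGradientAt_iff_isLittleO]
  refine Asymptotics.IsBigO.trans_isLittleO (g := fun w => ‖w - z‖ ^ 2) ?_ ?_
  · refine Asymptotics.IsBigO.of_bound μ⁻¹ (Filter.Eventually.of_forall fun w => ?_)
    have h₁ := conjugateAlong_ge hμ.le hsc hs z w
    have h₂ := conjugateAlong_ge hμ.le hsc hs w z
    have h₃ := real_inner_le_norm (s w - s z) (w - z)
    have h₄ := mul_le_mul_of_nonneg_right (hlip w) (norm_nonneg (w - z))
    rw [inner_sub_left] at h₃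
    rw [← neg_sub w z, inner_neg_right] at h₂
    rw [Real.norm_of_nonneg (by linarith), Real.norm_of_nonneg (by positivity)]
    nlinarith
  · exact Asymptotics.isLittleO_pow_sub_sub z one_lt_two

end StrongConvexity

section SaddlePoint

variable {E V : Type*} [NormedAddCommGroup E] [InnerProductSpace ℝ E] [CompleteSpace E]
  [NormedAddCommGroup V] [InnerProductSpace ℝ V] [CompleteSpace V]
  {F : E → ℝ} {F' : E → E} {G : V → ℝ} {G' : V → V} {μ ν : ℝ}

theorem exists_saddle_critical_point [ProperSpace E] [ProperSpace V] (hμ : 0 < μ) (hν : 0 < ν)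
    (hF : ∀ x, HasGradientAt F (F' x) x) (hG : ∀ y, HasGradientAt G (G' y) y)
    (hFsc : ∀ x y, F y ≥ F x + ⟪F' x, y - x⟫ + μ / 2 * ‖y - x‖ ^ 2)
    (hGsc : ∀ x y, G y ≥ G x + ⟪G' x, y - x⟫ + ν / 2 * ‖y - x‖ ^ 2) (A : E →L[ℝ] V) :
    ∃ x y, F' x + ContinuousLinearMap.adjoint A y = 0 ∧ G' y - A x = 0 := by
  choose s hs using exists_gradient_eq_of_strongly_convex hν hG hGsc
  obtain ⟨x, hx⟩ := exists_gradient_eq_zero_of_strongly_convex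
    (H := fun x => F x + conjugateAlong G s (A x))
    (H' := fun x => F' x + ContinuousLinearMap.adjoint A (s (A x))) hμ
    (fun x => by
      have h := (hF x).hasFDerivAt.add
        ((hasGradientAt_conjugateAlong hν hGsc hs (A x)).hasFDerivAt.comp x A.hasFDerivAt)
      have hdual : InnerProductSpace.toDual ℝ E
            (F' x + ContinuousLinearMap.adjoint A (s (A x))) =
          InnerProductSpace.toDual ℝ E (F' x) +
            (InnerProductSpace.toDual ℝ V (s (A x))).comp A := by
        ext v
        simp [ContinuousLinearMap.adjoint_inner_left]
      rw [← hdual] at h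
      exact h)
    (fun x y => by
      have h₁ := hFsc x y
      have h₂ := conjugateAlong_ge hν.le hGsc hs (A x) (A y)
      rw [inner_add_left, ContinuousLinearMap.adjoint_inner_left, map_sub]
      linarith)
  exact ⟨x, s (A x), hx, by rw [hs, sub_self]⟩

theorem saddle_critical_point_unique (hμ : 0 < μ) (hν : 0 < ν)
    (hFsc : ∀ x y, F y ≥ F x + ⟪F' x, y - x⟫ + μ / 2 * ‖y - x‖ ^ 2)
    (hGsc : ∀ x y, G y ≥ G x + ⟪G' x, y - x⟫ + ν / 2 * ‖y - x‖ ^ 2) (A : E →L[ℝ] V)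
    {p q : E × V}
    (hp : F' p.1 + ContinuousLinearMap.adjoint A p.2 = 0 ∧ G' p.2 - A p.1 = 0)
    (hq : F' q.1 + ContinuousLinearMap.adjoint A q.2 = 0 ∧ G' q.2 - A q.1 = 0) : p = q := by
  have h₁ := strongly_monotone_of_strongly_convex hFsc q.1 p.1
  have h₂ := strongly_monotone_of_strongly_convex hGsc q.2 p.2
  rw [eq_neg_of_add_eq_zero_left hp.1, eq_neg_of_add_eq_zero_left hq.1, neg_sub_neg, ← map_sub,
    ContinuousLinearMap.adjoint_inner_left, ← neg_sub p.2 q.2, inner_neg_left] at h₁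
  rw [sub_eq_zero.1 hp.2, sub_eq_zero.1 hq.2, ← map_sub, real_inner_comm] at h₂
  have h₃ : 0 ≤ μ * ‖p.1 - q.1‖ ^ 2 := by positivity
  have h₄ : 0 ≤ ν * ‖p.2 - q.2‖ ^ 2 := by positivity
  have h₅ : μ * ‖p.1 - q.1‖ ^ 2 = 0 := by linarith
  have h₆ : ν * ‖p.2 - q.2‖ ^ 2 = 0 := by linarith
  simp only [mul_eq_zero, hμ.ne', hν.ne', false_or, pow_eq_zero_iff two_ne_zero, norm_eq_zero,
    sub_eq_zero] at h₅ h₆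
  exact Prod.ext h₅ h₆

theorem saddle_point_iff_critical_point (hμ : 0 ≤ μ) (hν : 0 ≤ ν)
    (hF : ∀ x, HasGradientAt F (F' x) x) (hG : ∀ y, HasGradientAt G (G' y) y)
    (hFsc : ∀ x y, F y ≥ F x + ⟪F' x, y - x⟫ + μ / 2 * ‖y - x‖ ^ 2)
    (hGsc : ∀ x y, G y ≥ G x + ⟪G' x, y - x⟫ + ν / 2 * ‖y - x‖ ^ 2) (A : E →L[ℝ] V)
    {L : E → V → ℝ} (hL : ∀ x y, L x y = F x + ⟪A x, y⟫ - G y) (p : E × V) :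
    (∀ x y, L p.1 y ≤ L p.1 p.2 ∧ L p.1 p.2 ≤ L x p.2) ↔
      F' p.1 + ContinuousLinearMap.adjoint A p.2 = 0 ∧ G' p.2 - A p.1 = 0 := by
  simp only [hL]
  constructor
  · intro h
    constructor
    · have hgrad : HasGradientAt (fun x => F x + ⟪ContinuousLinearMap.adjoint A p.2, x⟫)
          (F' p.1 + ContinuousLinearMap.adjoint A p.2) p.1 := by
        have h := (hF p.1).hasFDerivAt.add
          (hasGradientAt_inner_right (ContinuousLinearMap.adjoint A p.2) p.1).hasFDerivAt
        rw [← map_add] at h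
        exact h
      refine hgrad.eq_zero_of_forall_le fun x => ?_
      have hx := (h x p.2).2
      simp only [ContinuousLinearMap.adjoint_inner_left, real_inner_comm _ p.2]
      linarith
    · have hgrad : HasGradientAt (fun y => G y - ⟪A p.1, y⟫) (G' p.2 - A p.1) p.2 := by
        have h := (hG p.2).hasFDerivAt.sub (hasGradientAt_inner_right (A p.1) p.2).hasFDerivAt
        rw [← map_sub] at h
        exact h
      refine hgrad.eq_zero_of_forall_le fun y => ?_
      have hy := (h p.1 y).1
      linarith
  · rintro ⟨h₁, h₂⟩ x y
    constructor
    · have h := hGsc p.2 y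
      have hsq : 0 ≤ ν / 2 * ‖y - p.2‖ ^ 2 := by positivity
      rw [sub_eq_zero.1 h₂, inner_sub_right] at h
      linarith
    · have h := hFsc p.1 x
      have hsq : 0 ≤ μ / 2 * ‖x - p.1‖ ^ 2 := by positivity
      rw [eq_neg_of_add_eq_zero_left h₁, inner_neg_left, ContinuousLinearMap.adjoint_inner_left,
        map_sub, inner_sub_right, real_inner_comm (A x), real_inner_comm (A p.1)] at h
      linarith

end SaddlePoint

theorem stmt_9 {n m : ℕ} (F : EuclideanSpace ℝ (Fin n) → ℝ)
    (G : EuclideanSpace ℝ (Fin m) → ℝ)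
    (F' : EuclideanSpace ℝ (Fin n) → EuclideanSpace ℝ (Fin n))
    (G' : EuclideanSpace ℝ (Fin m) → EuclideanSpace ℝ (Fin m))
    (μF μG : ℝ) (hμF : 0 < μF) (hμG : 0 < μG)
    (A : EuclideanSpace ℝ (Fin n) →L[ℝ] EuclideanSpace ℝ (Fin m))
    (hFdiff : ∀ x, HasGradientAt F (F' x) x)
    (hGdiff : ∀ y, HasGradientAt G (G' y) y)
    (hFsc : ∀ x y, F y ≥ F x + ⟪F' x, y - x⟫ + μF / 2 * ‖y - x‖ ^ 2)
    (hGsc : ∀ x y, G y ≥ G x + ⟪G' x, y - x⟫ + μG / 2 * ‖y - x‖ ^ 2)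
    (hFcont : Continuous F') (hGcont : Continuous G')
    (L : EuclideanSpace ℝ (Fin n) → EuclideanSpace ℝ (Fin m) → ℝ)
    (hL : ∀ x y, L x y = F x + ⟪A x, y⟫ - G y) :
    (∃! p : EuclideanSpace ℝ (Fin n) × EuclideanSpace ℝ (Fin m),
        F' p.1 + (ContinuousLinearMap.adjoint A) p.2 = 0 ∧ G' p.2 - A p.1 = 0) ∧
      (∃! p : EuclideanSpace ℝ (Fin n) × EuclideanSpace ℝ (Fin m),
        ∀ x y, L p.1 y ≤ L p.1 p.2 ∧ L p.1 p.2 ≤ L x p.2) := by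
  have hex : ∃! p : EuclideanSpace ℝ (Fin n) × EuclideanSpace ℝ (Fin m),
      F' p.1 + (ContinuousLinearMap.adjoint A) p.2 = 0 ∧ G' p.2 - A p.1 = 0 := by
    obtain ⟨x, y, h⟩ := exists_saddle_critical_point hμF hμG hFdiff hGdiff hFsc hGsc A
    exact ⟨(x, y), h, fun q hq => saddle_critical_point_unique hμF hμG hFsc hGsc A hq h⟩
  refine ⟨hex, ?_⟩
  simpa only [saddle_point_iff_critical_point hμF.le hμG.le hFdiff hGdiff hFsc hGsc A hL]
    using hex
end

section
/- Under Assumption 2 (F μ_F-strongly convex, G μ_G-strongly convex, ∇F and ∇G locally Lipschitz), let (x(t), y(t)) be a C² solution on [t_0, T) of the dynamical system ẍ + 2√μ_F ẋ + ∇F(x) + Aᵀ(y + γẏ) = 0, ÿ + 2√μ_G ẏ + ∇G(y) − A(x + γẋ) = 0 with γ = max{1/√μ_F, 1/√μ_G}, let (x*, y*) be the unique saddle point of L, and define E(t) = γ²(L(x(t), y*) − L(x*, y(t))) + (1/2)‖u(t)‖² + (1/2)‖v(t)‖² with u(t) = x(t) − x* + γẋ(t), v(t) = y(t) − y* + γẏ(t).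 Then for all t ∈ [t_0, T): Ė(t) ≤ −(1/γ)E(t) − (γ/2)(‖ẋ(t)‖² + ‖ẏ(t)‖²). -/
open scoped RealInnerProductSpace

lemma damped_energy_dissipation {H : Type*} [NormedAddCommGroup H] [InnerProductSpace ℝ H]
    {s γ Φ : ℝ} (hγ : 0 < γ) (hs : 1 ≤ γ * s) (X p g : H)
    (hΦ : Φ + s ^ 2 / 2 * ‖X‖ ^ 2 ≤ ⟪g, X⟫) :
    γ ^ 2 * ⟪g, p⟫ + ⟪X + γ • p, p - (2 * γ * s) • p - γ • g⟫ ≤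
      -(1 / γ) * (γ ^ 2 * Φ + 1 / 2 * ‖X + γ • p‖ ^ 2) - γ / 2 * ‖p‖ ^ 2 := by
  have hsq : 0 ≤ ‖X + (2 * γ) • p‖ ^ 2 := sq_nonneg _
  have hXX : 0 ≤ ‖X‖ ^ 2 := sq_nonneg _
  simp only [norm_add_sq_real, norm_smul, mul_pow, Real.norm_eq_abs, sq_abs, inner_add_left,
    inner_sub_right, real_inner_smul_left, real_inner_smul_right,
    real_inner_self_eq_norm_sq] at hsq ⊢
  rw [real_inner_comm p g, real_inner_comm X g] at *
  generalize ‖X‖ ^ 2 = a at *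
  generalize ‖p‖ ^ 2 = b at *
  generalize ⟪X, p⟫ = c at *
  generalize ⟪p, g⟫ = e at *
  generalize ⟪X, g⟫ = f at *
  have hsum : 0 ≤ (γ * s) * a + (a + 2 * (2 * γ * c) + (2 * γ) ^ 2 * b) :=
    add_nonneg (mul_nonneg (by linarith) hXX) (by linarith)
  have key : 0 ≤ (γ * s - 1) / (2 * γ) * ((γ * s) * a + (a + 2 * (2 * γ * c) + (2 * γ) ^ 2 * b)) :=
    mul_nonneg (div_nonneg (by linarith) (by positivity)) hsum
  have hmul := mul_le_mul_of_nonneg_left hΦ hγ.le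
  have e1 : (γ * s - 1) / (2 * γ) * ((γ * s) * a + (a + 2 * (2 * γ * c) + (2 * γ) ^ 2 * b)) =
      γ * s ^ 2 / 2 * a - 1 / (2 * γ) * a + 2 * (γ * s - 1) * c + 2 * γ * (γ * s - 1) * b := by
    field_simp
    ring
  have e2 : -(1 / γ) * (γ ^ 2 * Φ + 1 / 2 * (a + 2 * (γ * c) + γ ^ 2 * b)) - γ / 2 * b =
      -(γ * Φ) - 1 / (2 * γ) * a - c - γ * b := by
    field_simp
    ring
  rw [e1] at key
  rw [e2]
  linarith

theorem stmt_11 {n m : ℕ} (F : EuclideanSpace ℝ (Fin n) → ℝ)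
    (G : EuclideanSpace ℝ (Fin m) → ℝ)
    (F' : EuclideanSpace ℝ (Fin n) → EuclideanSpace ℝ (Fin n))
    (G' : EuclideanSpace ℝ (Fin m) → EuclideanSpace ℝ (Fin m))
    (μF μG : ℝ) (hμF : 0 < μF) (hμG : 0 < μG)
    (A : EuclideanSpace ℝ (Fin n) →L[ℝ] EuclideanSpace ℝ (Fin m))
    (hFdiff : ∀ z, HasGradientAt F (F' z) z)
    (hGdiff : ∀ z, HasGradientAt G (G' z) z)
    (hFsc : ∀ a b, F b ≥ F a + ⟪F' a, b - a⟫ + μF / 2 * ‖b - a‖ ^ 2)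
    (hGsc : ∀ a b, G b ≥ G a + ⟪G' a, b - a⟫ + μG / 2 * ‖b - a‖ ^ 2)
    (hFlip : LocallyLipschitz F') (hGlip : LocallyLipschitz G')
    (γ : ℝ) (hγ : γ = max (1 / Real.sqrt μF) (1 / Real.sqrt μG))
    (L : EuclideanSpace ℝ (Fin n) → EuclideanSpace ℝ (Fin m) → ℝ)
    (hL : ∀ p q, L p q = F p + ⟪A p, q⟫ - G q)
    (xstar : EuclideanSpace ℝ (Fin n)) (ystar : EuclideanSpace ℝ (Fin m))
    (hsaddle : ∀ p q, L xstar q ≤ L xstar ystar ∧ L xstar ystar ≤ L p ystar)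
    (hfoc1 : F' xstar + (ContinuousLinearMap.adjoint A) ystar = 0)
    (hfoc2 : G' ystar - A xstar = 0)
    (t0 : ℝ) (ht0 : 0 ≤ t0)
    (T : ℝ) (ht0T : t0 < T)
    (x x' x'' : ℝ → EuclideanSpace ℝ (Fin n))
    (y y' y'' : ℝ → EuclideanSpace ℝ (Fin m))
    (hx : ∀ t ∈ Set.Ico t0 T, HasDerivAt x (x' t) t)
    (hx' : ∀ t ∈ Set.Ico t0 T, HasDerivAt x' (x'' t) t)
    (hy : ∀ t ∈ Set.Ico t0 T, HasDerivAt y (y' t) t)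
    (hy' : ∀ t ∈ Set.Ico t0 T, HasDerivAt y' (y'' t) t)
    (hx''c : ContinuousOn x'' (Set.Ico t0 T)) (hy''c : ContinuousOn y'' (Set.Ico t0 T))
    (hode1 : ∀ t ∈ Set.Ico t0 T,
      x'' t + (2 * Real.sqrt μF) • x' t + F' (x t)
        + (ContinuousLinearMap.adjoint A) (y t + γ • y' t) = 0)
    (hode2 : ∀ t ∈ Set.Ico t0 T,
      y'' t + (2 * Real.sqrt μG) • y' t + G' (y t) - A (x t + γ • x' t) = 0)
    (u : ℝ → EuclideanSpace ℝ (Fin n)) (v : ℝ → EuclideanSpace ℝ (Fin m))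
    (hu : ∀ t, u t = x t - xstar + γ • x' t)
    (hv : ∀ t, v t = y t - ystar + γ • y' t)
    (E : ℝ → ℝ)
    (hE : ∀ t, E t = γ ^ 2 * (L (x t) ystar - L xstar (y t))
      + 1 / 2 * ‖u t‖ ^ 2 + 1 / 2 * ‖v t‖ ^ 2)
    : ∀ t ∈ Set.Ico t0 T, ∃ d : ℝ, HasDerivAt E d t ∧
      d ≤ -(1 / γ) * E t - γ / 2 * (‖x' t‖ ^ 2 + ‖y' t‖ ^ 2) := by
  intro t ht
  have hγF : 1 ≤ γ * √μF := by
    have h : 1 / √μF ≤ γ := hγ ▸ le_max_left _ _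
    rwa [div_le_iff₀ (Real.sqrt_pos.2 hμF)] at h
  have hγG : 1 ≤ γ * √μG := by
    have h : 1 / √μG ≤ γ := hγ ▸ le_max_right _ _
    rwa [div_le_iff₀ (Real.sqrt_pos.2 hμG)] at h
  have hγ0 : 0 < γ := by
    rw [hγ]
    exact lt_max_of_lt_left (one_div_pos.2 (Real.sqrt_pos.2 hμF))
  have hFx : HasDerivAt (fun r => F (x r)) ⟪F' (x t), x' t⟫ t := by
    have h := (hFdiff (x t)).hasFDerivAt.comp_hasDerivAt t (hx t ht)
    rw [InnerProductSpace.toDual_apply_apply] at h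
    exact h
  have hGy : HasDerivAt (fun r => G (y r)) ⟪G' (y t), y' t⟫ t := by
    have h := (hGdiff (y t)).hasFDerivAt.comp_hasDerivAt t (hy t ht)
    rw [InnerProductSpace.toDual_apply_apply] at h
    exact h
  have hAx : HasDerivAt (fun r => ⟪A (x r), ystar⟫) ⟪A (x' t), ystar⟫ t := by
    simpa using (A.hasFDerivAt.comp_hasDerivAt t (hx t ht)).inner ℝ (hasDerivAt_const t ystar)
  have hAy : HasDerivAt (fun r => ⟪A xstar, y r⟫) ⟪A xstar, y' t⟫ t := by
    simpa using (hasDerivAt_const t (A xstar)).inner ℝ (hy t ht)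
  have hud : HasDerivAt u (x' t + γ • x'' t) t := by
    rw [funext hu]
    exact ((hx t ht).sub_const xstar).add ((hx' t ht).const_smul γ)
  have hvd : HasDerivAt v (y' t + γ • y'' t) t := by
    rw [funext hv]
    exact ((hy t ht).sub_const ystar).add ((hy' t ht).const_smul γ)
  set g := F' (x t) + ContinuousLinearMap.adjoint A ystar with hg
  set k := G' (y t) - A xstar with hk
  have hxdd : x' t + γ • x'' t = (x' t - (2 * γ * √μF) • x' t - γ • g)
      - γ • ContinuousLinearMap.adjoint A (v t) := by
    have h : x'' t = -((2 * √μF) • x' t + F' (x t)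
        + ContinuousLinearMap.adjoint A (y t + γ • y' t)) := by
      rw [eq_neg_iff_add_eq_zero, ← hode1 t ht]
      abel
    rw [h, hg, hv]
    simp only [map_add, map_sub, map_smul]
    module
  have hydd : y' t + γ • y'' t = (y' t - (2 * γ * √μG) • y' t - γ • k) + γ • A (u t) := by
    have h : y'' t = -((2 * √μG) • y' t + G' (y t) - A (x t + γ • x' t)) := by
      rw [eq_neg_iff_add_eq_zero, ← hode2 t ht]
      abel
    rw [h, hk, hu]
    simp only [map_add, map_sub, map_smul]
    module
  have hcouple : ⟪u t, ContinuousLinearMap.adjoint A (v t)⟫ = ⟪v t, A (u t)⟫ := by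
    rw [ContinuousLinearMap.adjoint_inner_right, real_inner_comm]
  have hED : HasDerivAt E
      (γ ^ 2 * ((⟪F' (x t), x' t⟫ + ⟪A (x' t), ystar⟫) - (⟪A xstar, y' t⟫ - ⟪G' (y t), y' t⟫))
        + 1 / 2 * (2 * ⟪u t, x' t + γ • x'' t⟫) + 1 / 2 * (2 * ⟪v t, y' t + γ • y'' t⟫)) t := by
    have hE' : E = fun r => γ ^ 2 * ((F (x r) + ⟪A (x r), ystar⟫ - G ystar)
        - (F xstar + ⟪A xstar, y r⟫ - G (y r))) + 1 / 2 * ‖u r‖ ^ 2 + 1 / 2 * ‖v r‖ ^ 2 := by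
      funext r
      rw [hE, hL, hL]
    rw [hE']
    exact (((((hFx.add hAx).sub_const _).sub ((hAy.const_add _).sub hGy)).const_mul _).add
      (hud.norm_sq.const_mul _)).add (hvd.norm_sq.const_mul _)
  refine ⟨_, hED, ?_⟩
  have hF := damped_energy_dissipation (s := √μF)
    (Φ := F (x t) - F xstar + ⟪A (x t - xstar), ystar⟫) hγ0 hγF (x t - xstar) (x' t) g (by
      have h := hFsc (x t) xstar
      rw [← neg_sub (x t) xstar, inner_neg_right, norm_neg] at h
      rw [Real.sq_sqrt hμF.le, hg, inner_add_left, ContinuousLinearMap.adjoint_inner_left,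
        real_inner_comm ystar]
      linarith)
  have hG := damped_energy_dissipation (s := √μG)
    (Φ := G (y t) - G ystar - ⟪A xstar, y t - ystar⟫) hγ0 hγG (y t - ystar) (y' t) k (by
      have h := hGsc (y t) ystar
      rw [← neg_sub (y t) ystar, inner_neg_right, norm_neg] at h
      rw [Real.sq_sqrt hμG.le, hk, inner_sub_left]
      linarith)
  rw [← hu] at hF
  rw [← hv] at hG
  have hgp : ⟪g, x' t⟫ = ⟪F' (x t), x' t⟫ + ⟪A (x' t), ystar⟫ := by
    rw [hg, inner_add_left, ContinuousLinearMap.adjoint_inner_left, real_inner_comm ystar]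
  have hkq : ⟪k, y' t⟫ = ⟪G' (y t), y' t⟫ - ⟪A xstar, y' t⟫ := by
    rw [hk, inner_sub_left]
  rw [hgp] at hF
  rw [hkq] at hG
  rw [hxdd, hydd, inner_sub_right (u t) _ (γ • _), inner_add_right (v t), real_inner_smul_right,
    real_inner_smul_right (v t) (A (u t)), hcouple, hE, hL, hL]
  rw [map_sub, inner_sub_left] at hF
  rw [inner_sub_right (A xstar)] at hG
  linear_combination hF + hG
end

section
/- Let F : ℝ^n → ℝ be differentiable and μ_F-strongly convex, let (x(t), y(t)) be a C² solution on [t_0, T) of ẍ + 2√μ_F ẋ + ∇F(x) + Aᵀ(y + γẏ) = 0 (coupled with any C¹ function y), let γ ≥ 1/√μ_F, and let (x*, y*) satisfy ∇F(x*) = −Aᵀy*. With u(t) = x(t) − x* + γẋ(t) and v(t) = y(t) − y* + γẏ(t), for all t ∈ [t_0, T): (d/dt)(½‖u(t)‖²) ≤ −γ(F(x(t)) − F(x*) + ⟨x(t) − x*, Aᵀy*⟩) − γ⟨u(t), Aᵀv(t)⟩ − γ²⟨ẋ(t), ∇F(x(t)) + Aᵀy*⟩ − (1/(2γ))‖u(t)‖²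 − (γ/2)‖ẋ(t)‖² − ((μ_F γ² − 2√μ_F γ + 1)/(2γ))‖x(t) − x*‖². -/
open scoped RealInnerProductSpace

theorem stmt_12 {n m : ℕ} (F : EuclideanSpace ℝ (Fin n) → ℝ)
    (F' : EuclideanSpace ℝ (Fin n) → EuclideanSpace ℝ (Fin n))
    (μF : ℝ) (hμF : 0 < μF)
    (A : EuclideanSpace ℝ (Fin n) →L[ℝ] EuclideanSpace ℝ (Fin m))
    (hFdiff : ∀ z, HasGradientAt F (F' z) z)
    (hFsc : ∀ a b, F b ≥ F a + ⟪F' a, b - a⟫ + μF / 2 * ‖b - a‖ ^ 2)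
    (γ : ℝ) (hγ : γ ≥ 1 / Real.sqrt μF)
    (t0 T : ℝ)
    (x x' x'' : ℝ → EuclideanSpace ℝ (Fin n))
    (y y' : ℝ → EuclideanSpace ℝ (Fin m))
    (hx : ∀ t ∈ Set.Ico t0 T, HasDerivAt x (x' t) t)
    (hx' : ∀ t ∈ Set.Ico t0 T, HasDerivAt x' (x'' t) t)
    (hx'' : ContinuousOn x'' (Set.Ico t0 T))
    (hy : ∀ t ∈ Set.Ico t0 T, HasDerivAt y (y' t) t)
    (hy' : ContinuousOn y' (Set.Ico t0 T))
    (hode : ∀ t ∈ Set.Ico t0 T,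
      x'' t + (2 * Real.sqrt μF) • x' t + F' (x t)
        + (ContinuousLinearMap.adjoint A) (y t + γ • y' t) = 0)
    (xstar : EuclideanSpace ℝ (Fin n)) (ystar : EuclideanSpace ℝ (Fin m))
    (hfoc : F' xstar = -(ContinuousLinearMap.adjoint A) ystar)
    (u : ℝ → EuclideanSpace ℝ (Fin n)) (v : ℝ → EuclideanSpace ℝ (Fin m))
    (hu : ∀ t, u t = x t - xstar + γ • x' t)
    (hv : ∀ t, v t = y t - ystar + γ • y' t) :
    ∀ t ∈ Set.Ico t0 T, ∃ d : ℝ,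
      HasDerivAt (fun s => 1 / 2 * ‖u s‖ ^ 2) d t ∧
      d ≤ -γ * (F (x t) - F xstar + ⟪x t - xstar, (ContinuousLinearMap.adjoint A) ystar⟫)
          - γ * ⟪u t, (ContinuousLinearMap.adjoint A) (v t)⟫
          - γ ^ 2 * ⟪x' t, F' (x t) + (ContinuousLinearMap.adjoint A) ystar⟫
          - 1 / (2 * γ) * ‖u t‖ ^ 2 - γ / 2 * ‖x' t‖ ^ 2
          - (μF * γ ^ 2 - 2 * Real.sqrt μF * γ + 1) / (2 * γ) * ‖x t - xstar‖ ^ 2 := by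
  intro t ht
  have hs : 0 < Real.sqrt μF := Real.sqrt_pos.mpr hμF
  have hγ0 : 0 < γ := lt_of_lt_of_le (by positivity) hγ
  have hsγ : 1 ≤ Real.sqrt μF * γ := by
    rwa [ge_iff_le, div_le_iff₀ hs, mul_comm] at hγ
  have hderiv : HasDerivAt u (x' t + γ • x'' t) t := by
    rw [funext hu]
    exact ((hx t ht).sub_const xstar).add ((hx' t ht).const_smul γ)
  refine ⟨⟪u t, x' t + γ • x'' t⟫, ?_, ?_⟩
  · refine (hderiv.norm_sq.const_mul (1 / 2 : ℝ)).congr_deriv ?_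
    ring
  have hadj : (ContinuousLinearMap.adjoint A) (y t + γ • y' t)
      = (ContinuousLinearMap.adjoint A) (v t) + (ContinuousLinearMap.adjoint A) ystar := by
    rw [← map_add, hv]
    congr 1
    abel
  have hacc : x'' t = -((2 * Real.sqrt μF) • x' t + F' (x t)
      + ((ContinuousLinearMap.adjoint A) (v t) + (ContinuousLinearMap.adjoint A) ystar)) := by
    rw [← hadj, eq_neg_iff_add_eq_zero, ← hode t ht]
    abel
  have hconv := hFsc (x t) xstar
  rw [← neg_sub (x t) xstar, inner_neg_right, norm_neg, real_inner_comm] at hconv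
  rw [hacc, hu]
  generalize (ContinuousLinearMap.adjoint A) (v t) = w
  generalize (ContinuousLinearMap.adjoint A) ystar = a
  generalize x t - xstar = e at *
  generalize x' t = p
  generalize F' (x t) = g at *
  generalize Real.sqrt μF = s at *
  have hnorm : ‖e + γ • p‖ ^ 2 = ‖e‖ ^ 2 + 2 * γ * ⟪e, p⟫ + γ ^ 2 * ‖p‖ ^ 2 := by
    rw [norm_add_sq_real, real_inner_smul_right, norm_smul, mul_pow, Real.norm_eq_abs, sq_abs]
    ring
  have hquad : 0 ≤ (s * γ - 1) * (‖e + γ • p‖ ^ 2 / γ + γ * ‖p‖ ^ 2) :=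
    mul_nonneg (by linarith) (by positivity)
  have hconvγ := mul_le_mul_of_nonneg_left hconv hγ0.le
  rw [hnorm] at hquad ⊢
  simp only [inner_add_left, inner_add_right, inner_neg_right, real_inner_smul_left,
    real_inner_smul_right, real_inner_self_eq_norm_sq, smul_neg, smul_add]
  rw [← sub_nonneg]
  refine (add_nonneg hquad (sub_nonneg.mpr hconvγ)).trans_eq ?_
  field_simp
  ring
end

section
/- Under Assumption 2 (F μ_F-strongly convex, G μ_G-strongly convex, ∇F and ∇G locally Lipschitz), let (x(t), y(t)) be a C² solution on [t_0, T) of the dynamical system ẍ + 2√μ_F ẋ + ∇F(x) + Aᵀ(y + γẏ) = 0, ÿ + 2√μ_G ẏ + ∇G(y) − A(x + γẋ) = 0 with γ = max{1/√μ_F, 1/√μ_G}, and let E(t) be the associated energy. Then for all t ∈ [t_0, T): ‖ẋ(t)‖ ≤ (1/γ)(1 + 1/(γ√μ_F))√(2E(t_0)) and ‖ẏ(t)‖ ≤ (1/γ)(1 + 1/(γ√μ_G))√(2E(t_0)). -/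
open scoped RealInnerProductSpace

section DampedOscillator

variable {V : Type*} [NormedAddCommGroup V] [InnerProductSpace ℝ V]

/-- Under strong monotonicity of the force, the damping terms dissipate energy. -/
theorem damping_nonpos {a γ : ℝ} (hγ : 0 < γ) (haγ : 1 ≤ a * γ) {w p g : V}
    (hg : a ^ 2 * ‖w‖ ^ 2 ≤ ⟪w, g⟫) :
    (1 - 2 * a * γ) * (⟪w, p⟫ + γ * ‖p‖ ^ 2) - γ * ⟪w, g⟫ ≤ 0 := by
  have hsq : ‖γ • p + (1 / 2 : ℝ) • w‖ ^ 2
      = γ * (⟪w, p⟫ + γ * ‖p‖ ^ 2) + ‖w‖ ^ 2 / 4 := by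
    rw [norm_add_sq_real, norm_smul, norm_smul, inner_smul_left, inner_smul_right,
      real_inner_comm, mul_pow, mul_pow, Real.norm_eq_abs, Real.norm_eq_abs, sq_abs, sq_abs]
    simp only [conj_trivial]
    ring
  have hdamp : 0 ≤ (2 * a * γ - 1) * ‖γ • p + (1 / 2 : ℝ) • w‖ ^ 2 :=
    mul_nonneg (by linarith) (sq_nonneg _)
  have hcoef : 0 ≤ ((a * γ) ^ 2 - (2 * a * γ - 1) / 4) * ‖w‖ ^ 2 :=
    mul_nonneg (by nlinarith) (sq_nonneg _)
  have hforce : γ ^ 2 * (a ^ 2 * ‖w‖ ^ 2) ≤ γ ^ 2 * ⟪w, g⟫ :=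
    mul_le_mul_of_nonneg_left hg (sq_nonneg γ)
  rw [hsq] at hdamp
  refine nonpos_of_mul_nonpos_right (a := γ) ?_ hγ
  nlinarith

/-- The energy of one component of the primal-dual system, relative to the point `c`. -/
noncomputable def componentEnergy (F : V → ℝ) (F' : V → V) (γ : ℝ) (c p q : V) : ℝ :=
  γ ^ 2 * (F p - F c - ⟪F' c, p - c⟫) + 1 / 2 * ‖p - c + γ • q‖ ^ 2

variable {F : V → ℝ} {F' : V → V} {μ γ : ℝ}

theorem mul_sq_norm_sub_le_inner_of_stronglyConvex
    (hF : ∀ a b, F b ≥ F a + ⟪F' a, b - a⟫ + μ / 2 * ‖b - a‖ ^ 2) (p c : V) :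
    μ * ‖p - c‖ ^ 2 ≤ ⟪p - c, F' p - F' c⟫ := by
  have h₁ := hF c p
  have h₂ := hF p c
  rw [← neg_sub p c, inner_neg_right, norm_neg] at h₂
  rw [real_inner_comm, inner_sub_left]
  linarith

/-- Along a damped trajectory, the component energy grows at most by the work of the
external force `f`. -/
theorem exists_hasDerivAt_componentEnergy_le [CompleteSpace V]
    (hFd : ∀ z, HasGradientAt F (F' z) z)
    (hF : ∀ a b, F b ≥ F a + ⟪F' a, b - a⟫ + μ / 2 * ‖b - a‖ ^ 2)
    (hμ : 0 < μ) (hγ : 0 < γ) (hμγ : 1 ≤ √μ * γ) (c f : V) {x x' : ℝ → V} {x'' : V} {t : ℝ}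
    (hx : HasDerivAt x (x' t) t) (hx' : HasDerivAt x' x'' t)
    (hode : x'' + (2 * √μ) • x' t + (F' (x t) - F' c) + f = 0) :
    ∃ d ≤ -γ * ⟪x t - c + γ • x' t, f⟫,
      HasDerivAt (fun s => componentEnergy F F' γ c (x s) (x' s)) d t := by
  have hFx : HasDerivAt (fun s => F (x s)) ⟪F' (x t), x' t⟫ t :=
    (hFd (x t)).hasFDerivAt.comp_hasDerivAt t hx
  have hlin : HasDerivAt (fun s => ⟪F' c, x s - c⟫) ⟪F' c, x' t⟫ t := by
    simpa using (hasDerivAt_const t (F' c)).inner ℝ (hx.sub_const c)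
  have hnorm := ((hx.sub_const c).add (hx'.const_smul γ)).norm_sq
  refine ⟨_, ?_, (((hFx.sub_const (F c)).sub hlin).const_mul (γ ^ 2)).add
    (hnorm.const_mul (1 / 2))⟩
  have hmono := mul_sq_norm_sub_le_inner_of_stronglyConvex hF (x t) c
  rw [← Real.sq_sqrt hμ.le] at hmono
  have hdiss := damping_nonpos (p := x' t) hγ hμγ hmono
  have hx'' : x'' = -((2 * √μ) • x' t + (F' (x t) - F' c) + f) :=
    eq_neg_of_add_eq_zero_left (by rw [← hode]; abel)
  simp only [hx'', Pi.add_apply, Pi.smul_apply, inner_add_left, inner_add_right,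
    inner_sub_right, inner_smul_left, inner_smul_right, inner_neg_right, smul_neg, smul_add, conj_trivial,
    real_inner_self_eq_norm_sq] at hdiss ⊢
  rw [real_inner_comm (x' t) (F' (x t)), real_inner_comm (x' t) (F' c)]
  linarith

theorem sq_norm_add_le_two_mul_componentEnergy
    (hF : ∀ a b, F b ≥ F a + ⟪F' a, b - a⟫ + μ / 2 * ‖b - a‖ ^ 2) (c p q : V) :
    ‖p - c + γ • q‖ ^ 2 + γ ^ 2 * μ * ‖p - c‖ ^ 2 ≤ 2 * componentEnergy F F' γ c p q := by
  have h := mul_le_mul_of_nonneg_left (hF c p) (sq_nonneg γ)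
  unfold componentEnergy
  linarith

theorem componentEnergy_nonneg
    (hF : ∀ a b, F b ≥ F a + ⟪F' a, b - a⟫ + μ / 2 * ‖b - a‖ ^ 2) (hμ : 0 < μ) (c p q : V) :
    0 ≤ componentEnergy F F' γ c p q := by
  have h := sq_norm_add_le_two_mul_componentEnergy (γ := γ) hF c p q
  have : 0 ≤ ‖p - c + γ • q‖ ^ 2 + γ ^ 2 * μ * ‖p - c‖ ^ 2 := by positivity
  linarith

/-- A bound on the component energy controls the velocity. -/
theorem norm_velocity_le_of_componentEnergy_le
    (hF : ∀ a b, F b ≥ F a + ⟪F' a, b - a⟫ + μ / 2 * ‖b - a‖ ^ 2)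
    (hμ : 0 < μ) (hγ : 0 < γ) {c p q : V} {e : ℝ} (he : componentEnergy F F' γ c p q ≤ e) :
    ‖q‖ ≤ 1 / γ * (1 + 1 / (γ * √μ)) * √(2 * e) := by
  have h := sq_norm_add_le_two_mul_componentEnergy (γ := γ) hF c p q
  have hs : 0 < √μ := Real.sqrt_pos.mpr hμ
  have hu : ‖p - c + γ • q‖ ≤ √(2 * e) := by
    refine Real.le_sqrt_of_sq_le ?_
    have : 0 ≤ γ ^ 2 * μ * ‖p - c‖ ^ 2 := by positivity
    linarith
  have hw : γ * √μ * ‖p - c‖ ≤ √(2 * e) := by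
    refine Real.le_sqrt_of_sq_le ?_
    rw [mul_pow, mul_pow, Real.sq_sqrt hμ.le]
    have : 0 ≤ ‖p - c + γ • q‖ ^ 2 := by positivity
    linarith
  have htri : γ * ‖q‖ ≤ ‖p - c + γ • q‖ + ‖p - c‖ := by
    have := norm_sub_le (p - c + γ • q) (p - c)
    rwa [add_sub_cancel_left, norm_smul, Real.norm_of_nonneg hγ.le] at this
  have hw' : ‖p - c‖ ≤ √(2 * e) / (γ * √μ) := by
    rw [le_div_iff₀ (by positivity)]
    linarith
  calc ‖q‖ ≤ (√(2 * e) + √(2 * e) / (γ * √μ)) / γ := by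
        rw [le_div_iff₀ hγ]
        linarith
    _ = 1 / γ * (1 + 1 / (γ * √μ)) * √(2 * e) := by ring

end DampedOscillator

theorem stmt_13 {n m : ℕ} (F : EuclideanSpace ℝ (Fin n) → ℝ)
    (G : EuclideanSpace ℝ (Fin m) → ℝ)
    (F' : EuclideanSpace ℝ (Fin n) → EuclideanSpace ℝ (Fin n))
    (G' : EuclideanSpace ℝ (Fin m) → EuclideanSpace ℝ (Fin m))
    (μF μG : ℝ) (hμF : 0 < μF) (hμG : 0 < μG)
    (A : EuclideanSpace ℝ (Fin n) →L[ℝ] EuclideanSpace ℝ (Fin m))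
    (hFdiff : ∀ z, HasGradientAt F (F' z) z)
    (hGdiff : ∀ z, HasGradientAt G (G' z) z)
    (hFsc : ∀ a b, F b ≥ F a + ⟪F' a, b - a⟫ + μF / 2 * ‖b - a‖ ^ 2)
    (hGsc : ∀ a b, G b ≥ G a + ⟪G' a, b - a⟫ + μG / 2 * ‖b - a‖ ^ 2)
    (hFlip : LocallyLipschitz F') (hGlip : LocallyLipschitz G')
    (γ : ℝ) (hγ : γ = max (1 / Real.sqrt μF) (1 / Real.sqrt μG))
    (L : EuclideanSpace ℝ (Fin n) → EuclideanSpace ℝ (Fin m) → ℝ)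
    (hL : ∀ p q, L p q = F p + ⟪A p, q⟫ - G q)
    (xstar : EuclideanSpace ℝ (Fin n)) (ystar : EuclideanSpace ℝ (Fin m))
    (hsaddle : ∀ p q, L xstar q ≤ L xstar ystar ∧ L xstar ystar ≤ L p ystar)
    (hfoc1 : F' xstar + (ContinuousLinearMap.adjoint A) ystar = 0)
    (hfoc2 : G' ystar - A xstar = 0)
    (t0 : ℝ) (ht0 : 0 ≤ t0)
    (T : ℝ) (ht0T : t0 < T)
    (x x' x'' : ℝ → EuclideanSpace ℝ (Fin n))
    (y y' y'' : ℝ → EuclideanSpace ℝ (Fin m))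
    (hx : ∀ t ∈ Set.Ico t0 T, HasDerivAt x (x' t) t)
    (hx' : ∀ t ∈ Set.Ico t0 T, HasDerivAt x' (x'' t) t)
    (hy : ∀ t ∈ Set.Ico t0 T, HasDerivAt y (y' t) t)
    (hy' : ∀ t ∈ Set.Ico t0 T, HasDerivAt y' (y'' t) t)
    (hx''c : ContinuousOn x'' (Set.Ico t0 T)) (hy''c : ContinuousOn y'' (Set.Ico t0 T))
    (hode1 : ∀ t ∈ Set.Ico t0 T,
      x'' t + (2 * Real.sqrt μF) • x' t + F' (x t)
        + (ContinuousLinearMap.adjoint A) (y t + γ • y' t) = 0)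
    (hode2 : ∀ t ∈ Set.Ico t0 T,
      y'' t + (2 * Real.sqrt μG) • y' t + G' (y t) - A (x t + γ • x' t) = 0)
    (u : ℝ → EuclideanSpace ℝ (Fin n)) (v : ℝ → EuclideanSpace ℝ (Fin m))
    (hu : ∀ t, u t = x t - xstar + γ • x' t)
    (hv : ∀ t, v t = y t - ystar + γ • y' t)
    (E : ℝ → ℝ)
    (hE : ∀ t, E t = γ ^ 2 * (L (x t) ystar - L xstar (y t))
      + 1 / 2 * ‖u t‖ ^ 2 + 1 / 2 * ‖v t‖ ^ 2)
    : ∀ t ∈ Set.Ico t0 T,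
      ‖x' t‖ ≤ 1 / γ * (1 + 1 / (γ * Real.sqrt μF)) * Real.sqrt (2 * E t0) ∧
      ‖y' t‖ ≤ 1 / γ * (1 + 1 / (γ * Real.sqrt μG)) * Real.sqrt (2 * E t0) := by
  have hsF : 0 < √μF := Real.sqrt_pos.mpr hμF
  have hsG : 0 < √μG := Real.sqrt_pos.mpr hμG
  have hγF : 1 ≤ √μF * γ := by
    rw [mul_comm, ← div_le_iff₀ hsF, hγ]
    exact le_max_left _ _
  have hγG : 1 ≤ √μG * γ := by
    rw [mul_comm, ← div_le_iff₀ hsG, hγ]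
    exact le_max_right _ _
  have hγpos : 0 < γ := by
    rw [hγ]
    exact lt_max_of_lt_left (by positivity)
  have hF' : F' xstar = -(ContinuousLinearMap.adjoint A) ystar := eq_neg_of_add_eq_zero_left hfoc1
  have hG' : G' ystar = A xstar := sub_eq_zero.mp hfoc2
  have hEsum : ∀ t, E t = componentEnergy F F' γ xstar (x t) (x' t)
      + componentEnergy G G' γ ystar (y t) (y' t) := by
    intro t
    simp only [hE, hL, hu, hv, componentEnergy, hF', hG', inner_neg_left, inner_sub_right,
      ContinuousLinearMap.adjoint_inner_left]
    rw [real_inner_comm (A (x t)) ystar, real_inner_comm (A xstar) ystar]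
    ring
  have hderiv : ∀ t ∈ Set.Ico t0 T, ∃ d ≤ 0, HasDerivAt E d t := by
    intro t ht
    obtain ⟨d₁, hd₁, h₁⟩ := exists_hasDerivAt_componentEnergy_le hFdiff hFsc hμF hγpos hγF xstar
      ((ContinuousLinearMap.adjoint A) (v t)) (hx t ht) (hx' t ht) (by
        rw [← hode1 t ht, hF', hv]
        simp only [map_add, map_sub]
        abel)
    obtain ⟨d₂, hd₂, h₂⟩ := exists_hasDerivAt_componentEnergy_le hGdiff hGsc hμG hγpos hγG ystar
      (-A (u t)) (hy t ht) (hy' t ht) (by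
        rw [← hode2 t ht, hG', hu]
        simp only [map_add, map_sub]
        abel)
    refine ⟨d₁ + d₂, ?_, (h₁.add h₂).congr_of_eventuallyEq (.of_forall hEsum)⟩
    rw [← hu, ContinuousLinearMap.adjoint_inner_right] at hd₁
    rw [← hv, inner_neg_right, real_inner_comm] at hd₂
    linarith
  have hanti : AntitoneOn E (Set.Ico t0 T) := by
    refine antitoneOn_of_deriv_nonpos (convex_Ico t0 T) (fun t ht => ?_) (fun t ht => ?_)
      (fun t ht => ?_)
    · obtain ⟨d, -, hd⟩ := hderiv t ht
      exact hd.continuousAt.continuousWithinAt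
    · obtain ⟨d, -, hd⟩ := hderiv t (interior_subset ht)
      exact hd.differentiableAt.differentiableWithinAt
    · obtain ⟨d, hd0, hd⟩ := hderiv t (interior_subset ht)
      rwa [hd.deriv]
  intro t ht
  have hEt : E t ≤ E t0 := hanti ⟨le_rfl, ht0T⟩ ht ht.1
  rw [hEsum t] at hEt
  have hFnonneg := componentEnergy_nonneg (γ := γ) hFsc hμF xstar (x t) (x' t)
  have hGnonneg := componentEnergy_nonneg (γ := γ) hGsc hμG ystar (y t) (y' t)
  exact ⟨norm_velocity_le_of_componentEnergy_le hFsc hμF hγpos (by linarith),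
    norm_velocity_le_of_componentEnergy_le hGsc hμG hγpos (by linarith)⟩
end

section
/- Under Assumption 2 (F μ_F-strongly convex, G μ_G-strongly convex, ∇F and ∇G locally Lipschitz), let (x(t), y(t)) be a C² solution on [t_0, +∞) of the dynamical system ẍ + 2√μ_F ẋ + ∇F(x) + Aᵀ(y + γẏ) = 0, ÿ + 2√μ_G ẏ + ∇G(y) − A(x + γẋ) = 0 with γ = max{1/√μ_F, 1/√μ_G}, let (x*, y*) be the unique saddle point of L, and let E(t) be the associated energy. Then the function t ↦ e^{t/γ} E(t) is nonincreasing on [t_0, +∞); in particular E(t) ≤ e^{(t_0 − t)/γ} E(t_0) for all t ≥ t_0. -/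
open scoped RealInnerProductSpace

/-- Quadratic dissipation estimate: with `X` the displacement, `p` the velocity, `g` a gradient and
`f` a function gap satisfying a strong convexity bound of modulus `s ^ 2`, the energy
`γ ^ 2 * f + ‖X + γ • p‖ ^ 2 / 2` decays at rate `1 / γ`. -/
lemma energy_dissipation_nonpos {V : Type*} [NormedAddCommGroup V] [InnerProductSpace ℝ V]
    (X p g : V) (f s γ : ℝ) (hγ : 0 < γ) (hs : 1 ≤ γ * s)
    (hf : f + s ^ 2 / 2 * ‖X‖ ^ 2 ≤ ⟪g, X⟫) :
    γ ^ 2 * ⟪g, p⟫ + ⟪X + γ • p, (1 - 2 * (γ * s)) • p - γ • g⟫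
      + 1 / γ * (γ ^ 2 * f + 1 / 2 * ‖X + γ • p‖ ^ 2) ≤ 0 := by
  have hnorm : ‖X + γ • p‖ ^ 2 = ‖X‖ ^ 2 + 2 * (γ * ⟪X, p⟫) + γ ^ 2 * ‖p‖ ^ 2 := by
    rw [norm_add_sq_real, inner_smul_right, norm_smul, mul_pow, Real.norm_eq_abs, sq_abs]
  have hinner : ⟪X + γ • p, (1 - 2 * (γ * s)) • p - γ • g⟫
      = (1 - 2 * (γ * s)) * (⟪X, p⟫ + γ * ‖p‖ ^ 2) - γ * ⟪g, X⟫ - γ ^ 2 * ⟪g, p⟫ := by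
    simp only [inner_add_left, inner_sub_right, inner_smul_left, inner_smul_right,
      real_inner_self_eq_norm_sq, real_inner_comm g X, real_inner_comm g p, RCLike.conj_to_real]
    ring
  have hsq : 0 ≤ ‖X‖ ^ 2 + 2 * (γ * ⟪X, p⟫) + γ ^ 2 * ‖p‖ ^ 2 := hnorm ▸ sq_nonneg _
  rw [hinner, hnorm]
  set a := γ * s with ha
  have key : γ * (γ ^ 2 * ⟪g, p⟫
      + ((1 - 2 * a) * (⟪X, p⟫ + γ * ‖p‖ ^ 2) - γ * ⟪g, X⟫ - γ ^ 2 * ⟪g, p⟫)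
      + 1 / γ * (γ ^ 2 * f + 1 / 2 * (‖X‖ ^ 2 + 2 * (γ * ⟪X, p⟫) + γ ^ 2 * ‖p‖ ^ 2)))
      = γ ^ 2 * (f + s ^ 2 / 2 * ‖X‖ ^ 2 - ⟪g, X⟫)
        - (a - 1) * (‖X‖ ^ 2 + 2 * (γ * ⟪X, p⟫) + γ ^ 2 * ‖p‖ ^ 2)
        - (a - 1) * (γ ^ 2 * ‖p‖ ^ 2) - 1 / 2 * (γ ^ 2 * ‖p‖ ^ 2)
        - (a - 1) ^ 2 / 2 * ‖X‖ ^ 2 := by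
    rw [ha]
    field_simp
    ring
  refine nonpos_of_mul_nonpos_right (a := γ) ?_ hγ
  rw [key]
  have h1 : γ ^ 2 * (f + s ^ 2 / 2 * ‖X‖ ^ 2 - ⟪g, X⟫) ≤ 0 :=
    mul_nonpos_of_nonneg_of_nonpos (sq_nonneg γ) (by linarith)
  have h2 := mul_nonneg (sub_nonneg.2 hs) hsq
  have h3 : 0 ≤ (a - 1) * (γ ^ 2 * ‖p‖ ^ 2) := mul_nonneg (sub_nonneg.2 hs) (by positivity)
  have h4 : 0 ≤ γ ^ 2 * ‖p‖ ^ 2 := by positivity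
  have h5 : 0 ≤ (a - 1) ^ 2 / 2 * ‖X‖ ^ 2 := by positivity
  linarith

/-- If `E' + E / γ ≤ 0` on `[t₀, ∞)`, then `t ↦ exp (t / γ) * E t` is nonincreasing there. -/
lemma antitoneOn_exp_mul_of_hasDerivAt {E E' : ℝ → ℝ} {γ t₀ : ℝ}
    (hE : ∀ t ∈ Set.Ici t₀, HasDerivAt E (E' t) t)
    (hle : ∀ t ∈ Set.Ici t₀, E' t + 1 / γ * E t ≤ 0) :
    AntitoneOn (fun t => Real.exp (t / γ) * E t) (Set.Ici t₀) := by
  have hd : ∀ t ∈ Set.Ici t₀, HasDerivAt (fun t => Real.exp (t / γ) * E t)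
      (Real.exp (t / γ) * (1 / γ) * E t + Real.exp (t / γ) * E' t) t := fun t ht =>
    (((hasDerivAt_id t).div_const γ).exp).mul (hE t ht)
  refine antitoneOn_of_deriv_nonpos (convex_Ici t₀)
    (fun t ht => (hd t ht).continuousAt.continuousWithinAt)
    (fun t ht => (hd t (interior_subset ht)).differentiableAt.differentiableWithinAt)
    fun t ht => ?_
  rw [(hd t (interior_subset ht)).deriv]
  have := mul_nonpos_of_nonneg_of_nonpos (Real.exp_pos (t / γ)).le (hle t (interior_subset ht))
  linarith

theorem stmt_15 {n m : ℕ} (F : EuclideanSpace ℝ (Fin n) → ℝ)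
    (G : EuclideanSpace ℝ (Fin m) → ℝ)
    (F' : EuclideanSpace ℝ (Fin n) → EuclideanSpace ℝ (Fin n))
    (G' : EuclideanSpace ℝ (Fin m) → EuclideanSpace ℝ (Fin m))
    (μF μG : ℝ) (hμF : 0 < μF) (hμG : 0 < μG)
    (A : EuclideanSpace ℝ (Fin n) →L[ℝ] EuclideanSpace ℝ (Fin m))
    (hFdiff : ∀ z, HasGradientAt F (F' z) z)
    (hGdiff : ∀ z, HasGradientAt G (G' z) z)
    (hFsc : ∀ a b, F b ≥ F a + ⟪F' a, b - a⟫ + μF / 2 * ‖b - a‖ ^ 2)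
    (hGsc : ∀ a b, G b ≥ G a + ⟪G' a, b - a⟫ + μG / 2 * ‖b - a‖ ^ 2)
    (hFlip : LocallyLipschitz F') (hGlip : LocallyLipschitz G')
    (γ : ℝ) (hγ : γ = max (1 / Real.sqrt μF) (1 / Real.sqrt μG))
    (L : EuclideanSpace ℝ (Fin n) → EuclideanSpace ℝ (Fin m) → ℝ)
    (hL : ∀ p q, L p q = F p + ⟪A p, q⟫ - G q)
    (xstar : EuclideanSpace ℝ (Fin n)) (ystar : EuclideanSpace ℝ (Fin m))
    (hsaddle : ∀ p q, L xstar q ≤ L xstar ystar ∧ L xstar ystar ≤ L p ystar)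
    (hfoc1 : F' xstar + (ContinuousLinearMap.adjoint A) ystar = 0)
    (hfoc2 : G' ystar - A xstar = 0)
    (t0 : ℝ) (ht0 : 0 ≤ t0)
    (x x' x'' : ℝ → EuclideanSpace ℝ (Fin n))
    (y y' y'' : ℝ → EuclideanSpace ℝ (Fin m))
    (hx : ∀ t ∈ Set.Ici t0, HasDerivAt x (x' t) t)
    (hx' : ∀ t ∈ Set.Ici t0, HasDerivAt x' (x'' t) t)
    (hy : ∀ t ∈ Set.Ici t0, HasDerivAt y (y' t) t)
    (hy' : ∀ t ∈ Set.Ici t0, HasDerivAt y' (y'' t) t)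
    (hx''c : ContinuousOn x'' (Set.Ici t0)) (hy''c : ContinuousOn y'' (Set.Ici t0))
    (hode1 : ∀ t ∈ Set.Ici t0,
      x'' t + (2 * Real.sqrt μF) • x' t + F' (x t)
        + (ContinuousLinearMap.adjoint A) (y t + γ • y' t) = 0)
    (hode2 : ∀ t ∈ Set.Ici t0,
      y'' t + (2 * Real.sqrt μG) • y' t + G' (y t) - A (x t + γ • x' t) = 0)
    (u : ℝ → EuclideanSpace ℝ (Fin n)) (v : ℝ → EuclideanSpace ℝ (Fin m))
    (hu : ∀ t, u t = x t - xstar + γ • x' t)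
    (hv : ∀ t, v t = y t - ystar + γ • y' t)
    (E : ℝ → ℝ)
    (hE : ∀ t, E t = γ ^ 2 * (L (x t) ystar - L xstar (y t))
      + 1 / 2 * ‖u t‖ ^ 2 + 1 / 2 * ‖v t‖ ^ 2)
    : AntitoneOn (fun t => Real.exp (t / γ) * E t) (Set.Ici t0) ∧
      ∀ t, t0 ≤ t → E t ≤ Real.exp ((t0 - t) / γ) * E t0 := by
  have hγF : 1 ≤ γ * √μF := by
    rw [← div_le_iff₀ (Real.sqrt_pos.2 hμF), hγ]
    exact le_max_left _ _
  have hγG : 1 ≤ γ * √μG := by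
    rw [← div_le_iff₀ (Real.sqrt_pos.2 hμG), hγ]
    exact le_max_right _ _
  have hγ0 : 0 < γ := by
    rw [hγ]
    exact lt_max_of_lt_left (one_div_pos.2 (Real.sqrt_pos.2 hμF))
  have hF : ∀ t ∈ Set.Ici t0, HasDerivAt (fun t => F (x t)) ⟪F' (x t), x' t⟫ t := fun t ht => by
    exact (hFdiff (x t)).hasFDerivAt.comp_hasDerivAt t (hx t ht)
  have hG : ∀ t ∈ Set.Ici t0, HasDerivAt (fun t => G (y t)) ⟪G' (y t), y' t⟫ t := fun t ht => by
    exact (hGdiff (y t)).hasFDerivAt.comp_hasDerivAt t (hy t ht)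
  have hud : ∀ t ∈ Set.Ici t0, HasDerivAt u (x' t + γ • x'' t) t := fun t ht => by
    rw [funext hu]
    exact ((hx t ht).sub_const xstar).add ((hx' t ht).const_smul γ)
  have hvd : ∀ t ∈ Set.Ici t0, HasDerivAt v (y' t + γ • y'' t) t := fun t ht => by
    rw [funext hv]
    exact ((hy t ht).sub_const ystar).add ((hy' t ht).const_smul γ)
  have hEd : ∀ t ∈ Set.Ici t0, HasDerivAt E
      (γ ^ 2 * (⟪F' (x t), x' t⟫ + ⟪A (x' t), ystar⟫ - (⟪A xstar, y' t⟫ - ⟪G' (y t), y' t⟫))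
        + 1 / 2 * (2 * ⟪u t, x' t + γ • x'' t⟫) + 1 / 2 * (2 * ⟪v t, y' t + γ • y'' t⟫)) t := by
    intro t ht
    rw [funext hE]
    simp only [hL]
    have hA : HasDerivAt (fun t => ⟪A (x t), ystar⟫) ⟪A (x' t), ystar⟫ t := by
      simpa using (A.hasFDerivAt.comp_hasDerivAt t (hx t ht)).inner ℝ (hasDerivAt_const t ystar)
    have hAs : HasDerivAt (fun t => ⟪A xstar, y t⟫) ⟪A xstar, y' t⟫ t := by
      simpa using (hasDerivAt_const t (A xstar)).inner ℝ (hy t ht)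
    exact ((((((hF t ht).add hA).sub_const (G ystar)).sub
      ((hAs.const_add (F xstar)).sub (hG t ht))).const_mul (γ ^ 2)).add
      ((hud t ht).norm_sq.const_mul (1 / 2))).add ((hvd t ht).norm_sq.const_mul (1 / 2))
  have hanti : AntitoneOn (fun t => Real.exp (t / γ) * E t) (Set.Ici t0) := by
    refine antitoneOn_exp_mul_of_hasDerivAt hEd fun t ht => ?_
    have hAadj : ∀ p q, ⟪ContinuousLinearMap.adjoint A q, p⟫ = ⟪A p, q⟫ := fun p q => by
      rw [ContinuousLinearMap.adjoint_inner_left, real_inner_comm]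
    have hu' : x' t + γ • x'' t = ((1 - 2 * (γ * √μF)) • x' t
        - γ • (F' (x t) + ContinuousLinearMap.adjoint A ystar))
        - γ • ContinuousLinearMap.adjoint A (v t) := by
      have hx2 : x'' t = -((2 * √μF) • x' t + F' (x t)
          + ContinuousLinearMap.adjoint A (y t + γ • y' t)) := by
        rw [eq_neg_iff_add_eq_zero, ← hode1 t ht]
        abel
      have hvt : y t + γ • y' t = v t + ystar := by rw [hv]; abel
      rw [hx2, hvt, map_add]
      module
    have hv' : y' t + γ • y'' t = ((1 - 2 * (γ * √μG)) • y' t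
        - γ • (G' (y t) - A xstar)) + γ • A (u t) := by
      have hy2 : y'' t = -((2 * √μG) • y' t + G' (y t) - A (x t + γ • x' t)) := by
        rw [eq_neg_iff_add_eq_zero, ← hode2 t ht]
        abel
      have hut : x t + γ • x' t = u t + xstar := by rw [hu]; abel
      rw [hy2, hut, map_add]
      module
    have hdF := energy_dissipation_nonpos (x t - xstar) (x' t)
      (F' (x t) + ContinuousLinearMap.adjoint A ystar)
      (F (x t) - F xstar + ⟪A (x t - xstar), ystar⟫) (√μF) γ hγ0 hγF (by
        have h := hFsc (x t) xstar
        rw [← neg_sub (x t) xstar, inner_neg_right, norm_neg] at h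
        rw [inner_add_left, hAadj, Real.sq_sqrt hμF.le]
        linarith)
    have hdG := energy_dissipation_nonpos (y t - ystar) (y' t)
      (G' (y t) - A xstar)
      (G (y t) - G ystar - ⟪A xstar, y t - ystar⟫) (√μG) γ hγ0 hγG (by
        have h := hGsc (y t) ystar
        rw [← neg_sub (y t) ystar, inner_neg_right, norm_neg] at h
        rw [inner_sub_left, Real.sq_sqrt hμG.le]
        linarith)
    rw [← hu t, inner_add_left, hAadj, map_sub, inner_sub_left] at hdF
    rw [← hv t, inner_sub_left, inner_sub_right (A xstar)] at hdG
    have hcross : ⟪u t, ContinuousLinearMap.adjoint A (v t)⟫ = ⟪v t, A (u t)⟫ := by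
      rw [real_inner_comm, hAadj, real_inner_comm]
    rw [hE t, hL, hL, hu', hv', inner_sub_right (u t), inner_add_right (v t),
      inner_smul_right (u t) (ContinuousLinearMap.adjoint A (v t)),
      inner_smul_right (v t) (A (u t)), hcross]
    linarith
  refine ⟨hanti, fun t ht => ?_⟩
  have h : Real.exp (t / γ) * E t ≤ Real.exp (t0 / γ) * E t0 := hanti Set.self_mem_Ici ht ht
  rw [sub_div, Real.exp_sub, div_mul_eq_mul_div, le_div_iff₀ (Real.exp_pos _)]
  linarith
end

section
/- Under Assumption 2 (F μ_F-strongly convex, G μ_G-strongly convex, ∇F and ∇G locally Lipschitz), let (x(t), y(t)) be the global C² solution on [t_0, +∞) of the dynamical system ẍ + 2√μ_F ẋ + ∇F(x) + Aᵀ(y + γẏ) = 0, ÿ + 2√μ_G ẏ + ∇G(y) − A(x + γẋ) = 0 with γ = max{1/√μ_F, 1/√μ_G}, and let (x*, y*) be the unique saddle point of L. Then for all t ≥ t_0: L(x(t), y*) − L(x*, y(t)) ≤ (E(t_0)/γ²) · e^{(t_0 − t)/γ}, where 1/γ = min{√μ_F, √μ_G} and E is the associated energy. -/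
open scoped RealInnerProductSpace

/-- A function with `f' ≤ -f / γ` on `[t₀, ∞)` decays at least as fast as `exp (-t / γ)`. -/
theorem le_mul_exp_of_deriv_le_neg_div {f f' : ℝ → ℝ} {γ t₀ : ℝ}
    (hf : ∀ t ∈ Set.Ici t₀, HasDerivAt f (f' t) t)
    (hle : ∀ t ∈ Set.Ici t₀, f' t + f t / γ ≤ 0) {t : ℝ} (ht : t₀ ≤ t) :
    f t ≤ f t₀ * Real.exp ((t₀ - t) / γ) := by
  have hd : ∀ s ∈ Set.Ici t₀, HasDerivAt (fun s => f s * Real.exp (s / γ))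
      (f' s * Real.exp (s / γ) + f s * (Real.exp (s / γ) * (1 / γ))) s := fun s hs =>
    (hf s hs).mul ((hasDerivAt_id s).div_const γ).exp
  have hanti : AntitoneOn (fun s => f s * Real.exp (s / γ)) (Set.Ici t₀) := by
    refine antitoneOn_of_hasDerivWithinAt_nonpos (convex_Ici t₀)
      (fun s hs => (hd s hs).continuousAt.continuousWithinAt)
      (fun s hs => (hd s (interior_subset hs)).hasDerivWithinAt) fun s hs => ?_
    have h := mul_nonpos_of_nonpos_of_nonneg (hle s (interior_subset hs))
      (Real.exp_pos (s / γ)).le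
    calc _ = (f' s + f s / γ) * Real.exp (s / γ) := by ring
      _ ≤ 0 := h
  have h : f t * Real.exp (t / γ) ≤ f t₀ * Real.exp (t₀ / γ) :=
    hanti (Set.mem_Ici.2 le_rfl) (Set.mem_Ici.2 ht) ht
  rw [sub_div, Real.exp_sub, ← mul_div_assoc, le_div_iff₀ (Real.exp_pos _)]
  exact h

/-- Dissipation estimate for one block of the primal-dual dynamics: `w` is the displacement from
the equilibrium, `p` the velocity, `g` the gradient and `φ` the objective gap. -/
theorem dissipation_nonpos {V : Type*} [NormedAddCommGroup V] [InnerProductSpace ℝ V]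
    {w p g : V} {φ γ s : ℝ} (hγ : 0 < γ) (hs : 1 ≤ γ * s)
    (hφ : φ ≤ ⟪g, w⟫ - s ^ 2 / 2 * ‖w‖ ^ 2) :
    γ ^ 2 * ⟪g, p⟫ + ⟪w + γ • p, (1 - 2 * γ * s) • p - γ • g⟫
      + (γ ^ 2 * φ + 1 / 2 * ‖w + γ • p‖ ^ 2) / γ ≤ 0 := by
  have hsq : 0 ≤ ‖w + γ • p‖ ^ 2 := sq_nonneg _
  have hexp : ‖w + γ • p‖ ^ 2 = ‖w‖ ^ 2 + 2 * γ * ⟪w, p⟫ + γ ^ 2 * ‖p‖ ^ 2 := by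
    rw [norm_add_sq_real, inner_smul_right, norm_smul, mul_pow, Real.norm_eq_abs, sq_abs]
    ring
  have hin : ⟪w + γ • p, (1 - 2 * γ * s) • p - γ • g⟫
      = (1 - 2 * γ * s) * (⟪w, p⟫ + γ * ‖p‖ ^ 2) - γ * ⟪g, w⟫ - γ ^ 2 * ⟪g, p⟫ := by
    simp only [inner_add_left, inner_sub_right, inner_smul_left, inner_smul_right,
      real_inner_self_eq_norm_sq, real_inner_comm w g, real_inner_comm p g, conj_trivial]
    ring
  rw [hexp] at hsq
  have hfac : γ * ((1 - 2 * γ * s) * (⟪w, p⟫ + γ * ‖p‖ ^ 2) - γ * ⟪g, w⟫)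
      + (γ ^ 2 * φ + 1 / 2 * (‖w‖ ^ 2 + 2 * γ * ⟪w, p⟫ + γ ^ 2 * ‖p‖ ^ 2)) ≤ 0 := by
    have h₁ := mul_le_mul_of_nonneg_left hφ (sq_nonneg γ)
    have h₂ := mul_nonneg (sub_nonneg.2 hs) hsq
    have h₃ : 0 ≤ (γ * s - 1) ^ 2 * ‖w‖ ^ 2 := by positivity
    have h₄ : 0 ≤ (γ * s - 1) * (γ ^ 2 * ‖p‖ ^ 2) :=
      mul_nonneg (sub_nonneg.2 hs) (by positivity)
    have h₅ : 0 ≤ γ ^ 2 * ‖p‖ ^ 2 := by positivity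
    linarith
  rw [hin, hexp]
  calc _ = (γ * ((1 - 2 * γ * s) * (⟪w, p⟫ + γ * ‖p‖ ^ 2) - γ * ⟪g, w⟫)
      + (γ ^ 2 * φ + 1 / 2 * (‖w‖ ^ 2 + 2 * γ * ⟪w, p⟫ + γ ^ 2 * ‖p‖ ^ 2))) / γ := by
        field_simp
        ring
    _ ≤ 0 := div_nonpos_of_nonpos_of_nonneg hfac hγ.le

theorem stmt_16 {n m : ℕ} (F : EuclideanSpace ℝ (Fin n) → ℝ)
    (G : EuclideanSpace ℝ (Fin m) → ℝ)
    (F' : EuclideanSpace ℝ (Fin n) → EuclideanSpace ℝ (Fin n))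
    (G' : EuclideanSpace ℝ (Fin m) → EuclideanSpace ℝ (Fin m))
    (μF μG : ℝ) (hμF : 0 < μF) (hμG : 0 < μG)
    (A : EuclideanSpace ℝ (Fin n) →L[ℝ] EuclideanSpace ℝ (Fin m))
    (hFdiff : ∀ z, HasGradientAt F (F' z) z)
    (hGdiff : ∀ z, HasGradientAt G (G' z) z)
    (hFsc : ∀ a b, F b ≥ F a + ⟪F' a, b - a⟫ + μF / 2 * ‖b - a‖ ^ 2)
    (hGsc : ∀ a b, G b ≥ G a + ⟪G' a, b - a⟫ + μG / 2 * ‖b - a‖ ^ 2)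
    (hFlip : LocallyLipschitz F') (hGlip : LocallyLipschitz G')
    (γ : ℝ) (hγ : γ = max (1 / Real.sqrt μF) (1 / Real.sqrt μG))
    (L : EuclideanSpace ℝ (Fin n) → EuclideanSpace ℝ (Fin m) → ℝ)
    (hL : ∀ p q, L p q = F p + ⟪A p, q⟫ - G q)
    (xstar : EuclideanSpace ℝ (Fin n)) (ystar : EuclideanSpace ℝ (Fin m))
    (hsaddle : ∀ p q, L xstar q ≤ L xstar ystar ∧ L xstar ystar ≤ L p ystar)
    (hfoc1 : F' xstar + (ContinuousLinearMap.adjoint A) ystar = 0)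
    (hfoc2 : G' ystar - A xstar = 0)
    (t0 : ℝ) (ht0 : 0 ≤ t0)
    (x x' x'' : ℝ → EuclideanSpace ℝ (Fin n))
    (y y' y'' : ℝ → EuclideanSpace ℝ (Fin m))
    (hx : ∀ t ∈ Set.Ici t0, HasDerivAt x (x' t) t)
    (hx' : ∀ t ∈ Set.Ici t0, HasDerivAt x' (x'' t) t)
    (hy : ∀ t ∈ Set.Ici t0, HasDerivAt y (y' t) t)
    (hy' : ∀ t ∈ Set.Ici t0, HasDerivAt y' (y'' t) t)
    (hx''c : ContinuousOn x'' (Set.Ici t0)) (hy''c : ContinuousOn y'' (Set.Ici t0))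
    (hode1 : ∀ t ∈ Set.Ici t0,
      x'' t + (2 * Real.sqrt μF) • x' t + F' (x t)
        + (ContinuousLinearMap.adjoint A) (y t + γ • y' t) = 0)
    (hode2 : ∀ t ∈ Set.Ici t0,
      y'' t + (2 * Real.sqrt μG) • y' t + G' (y t) - A (x t + γ • x' t) = 0)
    (u : ℝ → EuclideanSpace ℝ (Fin n)) (v : ℝ → EuclideanSpace ℝ (Fin m))
    (hu : ∀ t, u t = x t - xstar + γ • x' t)
    (hv : ∀ t, v t = y t - ystar + γ • y' t)
    (E : ℝ → ℝ)
    (hE : ∀ t, E t = γ ^ 2 * (L (x t) ystar - L xstar (y t))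
      + 1 / 2 * ‖u t‖ ^ 2 + 1 / 2 * ‖v t‖ ^ 2)
    : ∀ t, t0 ≤ t →
      L (x t) ystar - L xstar (y t) ≤ E t0 / γ ^ 2 * Real.exp ((t0 - t) / γ) := by
  intro t ht
  have hsF : 0 < Real.sqrt μF := Real.sqrt_pos.2 hμF
  have hsG : 0 < Real.sqrt μG := Real.sqrt_pos.2 hμG
  have hγF : 1 ≤ γ * Real.sqrt μF := by
    rw [← div_le_iff₀ hsF, hγ]
    exact le_max_left _ _
  have hγG : 1 ≤ γ * Real.sqrt μG := by
    rw [← div_le_iff₀ hsG, hγ]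
    exact le_max_right _ _
  have hγ0 : 0 < γ := pos_of_mul_pos_left (one_pos.trans_le hγF) hsF.le
  let gx : ℝ → EuclideanSpace ℝ (Fin n) := fun s =>
    F' (x s) + (ContinuousLinearMap.adjoint A) ystar
  let gy : ℝ → EuclideanSpace ℝ (Fin m) := fun s => G' (y s) - A xstar
  have hderiv : ∀ s ∈ Set.Ici t0, HasDerivAt E
      (γ ^ 2 * (⟪gx s, x' s⟫ + ⟪gy s, y' s⟫) + ⟪u s, x' s + γ • x'' s⟫
        + ⟪v s, y' s + γ • y'' s⟫) s := by
    intro s hs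
    have hFs : HasDerivAt (fun r => F (x r)) ⟪F' (x s), x' s⟫ s := by
      exact (hFdiff (x s)).hasFDerivAt.comp_hasDerivAt s (hx s hs)
    have hGs : HasDerivAt (fun r => G (y r)) ⟪G' (y s), y' s⟫ s := by
      exact (hGdiff (y s)).hasFDerivAt.comp_hasDerivAt s (hy s hs)
    have hAx : HasDerivAt (fun r => ⟪A (x r), ystar⟫) ⟪A (x' s), ystar⟫ s := by
      simpa using (A.hasFDerivAt.comp_hasDerivAt s (hx s hs)).inner ℝ
        (hasDerivAt_const s ystar)
    have hAy : HasDerivAt (fun r => ⟪A xstar, y r⟫) ⟪A xstar, y' s⟫ s := by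
      simpa using (hasDerivAt_const s (A xstar)).inner ℝ (hy s hs)
    have hus : HasDerivAt u (x' s + γ • x'' s) s := by
      rw [funext hu]
      exact ((hx s hs).sub_const xstar).add ((hx' s hs).const_smul γ)
    have hvs : HasDerivAt v (y' s + γ • y'' s) s := by
      rw [funext hv]
      exact ((hy s hs).sub_const ystar).add ((hy' s hs).const_smul γ)
    rw [funext hE]
    simp only [hL]
    refine HasDerivAt.congr_deriv ((((((hFs.add hAx).sub_const (G ystar)).sub
      ((hAy.const_add (F xstar)).sub hGs)).const_mul (γ ^ 2)).add
      (hus.norm_sq.const_mul (1 / 2))).add (hvs.norm_sq.const_mul (1 / 2))) ?_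
    simp only [gx, gy, inner_add_left, inner_sub_left, ContinuousLinearMap.adjoint_inner_left,
      real_inner_comm ystar (A (x' s))]
    ring
  have hdiss : ∀ s ∈ Set.Ici t0,
      (γ ^ 2 * (⟪gx s, x' s⟫ + ⟪gy s, y' s⟫) + ⟪u s, x' s + γ • x'' s⟫
        + ⟪v s, y' s + γ • y'' s⟫) + E s / γ ≤ 0 := by
    intro s hs
    have hφ : F (x s) - F xstar + ⟪A (x s - xstar), ystar⟫
        ≤ ⟪gx s, x s - xstar⟫ - Real.sqrt μF ^ 2 / 2 * ‖x s - xstar‖ ^ 2 := by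
      have h := hFsc (x s) xstar
      rw [← neg_sub (x s) xstar, norm_neg, inner_neg_right] at h
      simp only [gx, Real.sq_sqrt hμF.le, inner_add_left,
        ContinuousLinearMap.adjoint_inner_left, real_inner_comm ystar]
      linarith
    have hψ : G (y s) - G ystar - ⟪A xstar, y s - ystar⟫
        ≤ ⟪gy s, y s - ystar⟫ - Real.sqrt μG ^ 2 / 2 * ‖y s - ystar‖ ^ 2 := by
      have h := hGsc (y s) ystar
      rw [← neg_sub (y s) ystar, norm_neg, inner_neg_right] at h
      simp only [gy, Real.sq_sqrt hμG.le, inner_sub_left]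
      linarith
    have hx2 : x' s + γ • x'' s = ((1 - 2 * γ * Real.sqrt μF) • x' s - γ • gx s)
        - γ • (ContinuousLinearMap.adjoint A) (v s) := by
      have h : x'' s = -((2 * Real.sqrt μF) • x' s + F' (x s)
          + (ContinuousLinearMap.adjoint A) (y s + γ • y' s)) := by
        rw [eq_neg_iff_add_eq_zero, ← hode1 s hs]
        abel
      rw [h, hv]
      simp only [gx, map_add, map_sub, map_smul]
      module
    have hy2 : y' s + γ • y'' s = ((1 - 2 * γ * Real.sqrt μG) • y' s - γ • gy s)
        + γ • A (u s) := by
      have h : y'' s = -((2 * Real.sqrt μG) • y' s + G' (y s) - A (x s + γ • x' s)) := by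
        rw [eq_neg_iff_add_eq_zero, ← hode2 s hs]
        abel
      rw [h, hu]
      simp only [gy, map_add, map_sub, map_smul]
      module
    have hX := dissipation_nonpos (p := x' s) hγ0 hγF hφ
    have hY := dissipation_nonpos (p := y' s) hγ0 hγG hψ
    rw [← hu] at hX
    rw [← hv] at hY
    have hgap : L (x s) ystar - L xstar (y s)
        = (F (x s) - F xstar + ⟪A (x s - xstar), ystar⟫)
          + (G (y s) - G ystar - ⟪A xstar, y s - ystar⟫) := by
      simp only [hL, map_sub, inner_sub_left, inner_sub_right]
      ring
    rw [hx2, hy2, inner_sub_right (u s), inner_add_right (v s), inner_smul_right (u s),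
      inner_smul_right (v s), ContinuousLinearMap.adjoint_inner_right,
      real_inner_comm (A (u s)) (v s), hE, hgap]
    refine le_of_eq_of_le ?_ (add_nonpos hX hY)
    ring
  have hdecay := le_mul_exp_of_deriv_le_neg_div hderiv hdiss ht
  rw [div_mul_eq_mul_div, le_div_iff₀ (by positivity)]
  refine le_trans ?_ hdecay
  rw [hE]
  nlinarith [sq_nonneg ‖u t‖, sq_nonneg ‖v t‖]
end

section
/- Under Assumption 2 (F μ_F-strongly convex, G μ_G-strongly convex, ∇F and ∇G locally Lipschitz), let (x(t), y(t)) be the global C² solution on [t_0, +∞) of the dynamical system ẍ + 2√μ_F ẋ + ∇F(x) + Aᵀ(y + γẏ) = 0, ÿ + 2√μ_G ẏ + ∇G(y) − A(x + γẋ) = 0 with γ = max{1/√μ_F, 1/√μ_G}, and let (x*, y*) be the unique saddle point of L. Then for all t ≥ t_0: (μ_F/2)‖x(t) − x*‖² + (μ_G/2)‖y(t) − y*‖² ≤ (E(t_0)/γ²) · e^{(t_0 − t)/γ}; in particular ‖x(t) − x*‖² + ‖y(t) − y*‖² = O(e^{−min{√μ_F, √μ_G} t}). -/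
open scoped RealInnerProductSpace

/-- Differential form of exponential decay: `f' ≤ -c f` on `[t₀, ∞)` forces
`f t ≤ f t₀ * exp (c * (t₀ - t))`. -/
theorem le_mul_exp_of_hasDerivAt_add_mul_nonpos {f f' : ℝ → ℝ} {c t₀ : ℝ}
    (hf : ∀ t ∈ Set.Ici t₀, HasDerivAt f (f' t) t)
    (hle : ∀ t ∈ Set.Ici t₀, f' t + c * f t ≤ 0) {t : ℝ} (ht : t₀ ≤ t) :
    f t ≤ f t₀ * Real.exp (c * (t₀ - t)) := by
  have hder : ∀ r ∈ Set.Ici t₀, HasDerivAt (fun r => f r * Real.exp (c * r))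
      ((f' r + c * f r) * Real.exp (c * r)) r := by
    intro r hr
    have hexp : HasDerivAt (fun r => Real.exp (c * r)) (Real.exp (c * r) * (c * 1)) r :=
      ((hasDerivAt_id' r).const_mul c).exp
    exact ((hf r hr).mul hexp).congr_deriv (by ring)
  have hanti : AntitoneOn (fun r => f r * Real.exp (c * r)) (Set.Ici t₀) := by
    refine antitoneOn_of_deriv_nonpos (convex_Ici t₀)
      (fun r hr => (hder r hr).continuousAt.continuousWithinAt) ?_ ?_
    · intro r hr
      exact (hder r (interior_subset hr)).differentiableAt.differentiableWithinAt
    · intro r hr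
      rw [(hder r (interior_subset hr)).deriv]
      exact mul_nonpos_of_nonpos_of_nonneg (hle r (interior_subset hr)) (Real.exp_pos _).le
  have h : f t * Real.exp (c * t) ≤ f t₀ * Real.exp (c * t₀) :=
    hanti Set.self_mem_Ici (Set.mem_Ici.2 ht) ht
  rw [mul_sub, Real.exp_sub, ← mul_div_assoc, le_div_iff₀ (Real.exp_pos _)]
  exact h

/-- Dissipation estimate for one component of a damped inertial system with damping `2 * s`,
where `d` is the displacement, `w` the velocity, `p` the gradient and `e` the potential gap. -/
theorem inertial_dissipation_nonpos {H : Type*} [NormedAddCommGroup H] [InnerProductSpace ℝ H]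
    {d w p : H} {e s γ : ℝ} (hγ : 0 < γ) (hs : 1 ≤ γ * s)
    (hp : e + s ^ 2 / 2 * ‖d‖ ^ 2 ≤ ⟪p, d⟫) :
    γ ^ 2 * ⟪p, w⟫ + ⟪d + γ • w, w - γ • ((2 * s) • w + p)⟫
      + γ⁻¹ * (γ ^ 2 * e + 1 / 2 * ‖d + γ • w‖ ^ 2) ≤ 0 := by
  have hadd : 0 ≤ ‖d‖ ^ 2 + 2 * (γ * ⟪d, w⟫) + γ ^ 2 * ‖w‖ ^ 2 := by
    have h := sq_nonneg ‖d + γ • w‖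
    rw [norm_add_sq_real, norm_smul, inner_smul_right, mul_pow, Real.norm_eq_abs, sq_abs] at h
    exact h
  have hexpand : γ * (γ ^ 2 * ⟪p, w⟫ + ⟪d + γ • w, w - γ • ((2 * s) • w + p)⟫
      + γ⁻¹ * (γ ^ 2 * e + 1 / 2 * ‖d + γ • w‖ ^ 2)) =
      γ ^ 2 * (e + s ^ 2 / 2 * ‖d‖ ^ 2 - ⟪p, d⟫)
      - (γ * s - 1) * (‖d‖ ^ 2 + 2 * (γ * ⟪d, w⟫) + γ ^ 2 * ‖w‖ ^ 2)
      - (γ * s - 1) ^ 2 / 2 * ‖d‖ ^ 2 - (γ * s - 1 / 2) * (γ ^ 2 * ‖w‖ ^ 2) := by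
    rw [norm_add_sq_real, norm_smul, mul_pow, Real.norm_eq_abs, sq_abs]
    simp only [inner_add_left, inner_sub_right, inner_add_right, real_inner_smul_left,
      real_inner_smul_right, real_inner_self_eq_norm_sq, real_inner_comm p]
    field_simp
    ring
  refine nonpos_of_mul_nonpos_right (a := γ) ?_ hγ
  rw [hexpand]
  have h1 : γ ^ 2 * (e + s ^ 2 / 2 * ‖d‖ ^ 2 - ⟪p, d⟫) ≤ 0 :=
    mul_nonpos_of_nonneg_of_nonpos (sq_nonneg γ) (sub_nonpos.2 hp)
  have h2 := mul_nonneg (sub_nonneg.2 hs) hadd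
  have h3 : 0 ≤ (γ * s - 1) ^ 2 / 2 * ‖d‖ ^ 2 := by positivity
  have h4 : 0 ≤ (γ * s - 1 / 2) * (γ ^ 2 * ‖w‖ ^ 2) :=
    mul_nonneg (by linarith) (by positivity)
  linarith

theorem stmt_17 {n m : ℕ} (F : EuclideanSpace ℝ (Fin n) → ℝ)
    (G : EuclideanSpace ℝ (Fin m) → ℝ)
    (F' : EuclideanSpace ℝ (Fin n) → EuclideanSpace ℝ (Fin n))
    (G' : EuclideanSpace ℝ (Fin m) → EuclideanSpace ℝ (Fin m))
    (μF μG : ℝ) (hμF : 0 < μF) (hμG : 0 < μG)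
    (A : EuclideanSpace ℝ (Fin n) →L[ℝ] EuclideanSpace ℝ (Fin m))
    (hFdiff : ∀ z, HasGradientAt F (F' z) z)
    (hGdiff : ∀ z, HasGradientAt G (G' z) z)
    (hFsc : ∀ a b, F b ≥ F a + ⟪F' a, b - a⟫ + μF / 2 * ‖b - a‖ ^ 2)
    (hGsc : ∀ a b, G b ≥ G a + ⟪G' a, b - a⟫ + μG / 2 * ‖b - a‖ ^ 2)
    (hFlip : LocallyLipschitz F') (hGlip : LocallyLipschitz G')
    (γ : ℝ) (hγ : γ = max (1 / Real.sqrt μF) (1 / Real.sqrt μG))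
    (L : EuclideanSpace ℝ (Fin n) → EuclideanSpace ℝ (Fin m) → ℝ)
    (hL : ∀ p q, L p q = F p + ⟪A p, q⟫ - G q)
    (xstar : EuclideanSpace ℝ (Fin n)) (ystar : EuclideanSpace ℝ (Fin m))
    (hsaddle : ∀ p q, L xstar q ≤ L xstar ystar ∧ L xstar ystar ≤ L p ystar)
    (hfoc1 : F' xstar + (ContinuousLinearMap.adjoint A) ystar = 0)
    (hfoc2 : G' ystar - A xstar = 0)
    (t0 : ℝ) (ht0 : 0 ≤ t0)
    (x x' x'' : ℝ → EuclideanSpace ℝ (Fin n))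
    (y y' y'' : ℝ → EuclideanSpace ℝ (Fin m))
    (hx : ∀ t ∈ Set.Ici t0, HasDerivAt x (x' t) t)
    (hx' : ∀ t ∈ Set.Ici t0, HasDerivAt x' (x'' t) t)
    (hy : ∀ t ∈ Set.Ici t0, HasDerivAt y (y' t) t)
    (hy' : ∀ t ∈ Set.Ici t0, HasDerivAt y' (y'' t) t)
    (hx''c : ContinuousOn x'' (Set.Ici t0)) (hy''c : ContinuousOn y'' (Set.Ici t0))
    (hode1 : ∀ t ∈ Set.Ici t0,
      x'' t + (2 * Real.sqrt μF) • x' t + F' (x t)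
        + (ContinuousLinearMap.adjoint A) (y t + γ • y' t) = 0)
    (hode2 : ∀ t ∈ Set.Ici t0,
      y'' t + (2 * Real.sqrt μG) • y' t + G' (y t) - A (x t + γ • x' t) = 0)
    (u : ℝ → EuclideanSpace ℝ (Fin n)) (v : ℝ → EuclideanSpace ℝ (Fin m))
    (hu : ∀ t, u t = x t - xstar + γ • x' t)
    (hv : ∀ t, v t = y t - ystar + γ • y' t)
    (E : ℝ → ℝ)
    (hE : ∀ t, E t = γ ^ 2 * (L (x t) ystar - L xstar (y t))
      + 1 / 2 * ‖u t‖ ^ 2 + 1 / 2 * ‖v t‖ ^ 2)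
    : ∀ t, t0 ≤ t →
      μF / 2 * ‖x t - xstar‖ ^ 2 + μG / 2 * ‖y t - ystar‖ ^ 2 ≤
        E t0 / γ ^ 2 * Real.exp ((t0 - t) / γ) := by
  intro t ht
  have hsF := Real.sqrt_pos.2 hμF
  have hsG := Real.sqrt_pos.2 hμG
  have hγpos : 0 < γ := hγ ▸ lt_max_of_lt_left (by positivity)
  have hγF : 1 ≤ γ * √μF := (div_le_iff₀ hsF).1 (hγ ▸ le_max_left _ _)
  have hγG : 1 ≤ γ * √μG := (div_le_iff₀ hsG).1 (hγ ▸ le_max_right _ _)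
  have hF0 : F' xstar = -(ContinuousLinearMap.adjoint A) ystar := eq_neg_of_add_eq_zero_left hfoc1
  have hG0 : G' ystar = A xstar := sub_eq_zero.1 hfoc2
  have hgap : ∀ p q, L p ystar - L xstar q =
      (F p - F xstar + ⟪A (p - xstar), ystar⟫) + (G q - G ystar - ⟪A xstar, q - ystar⟫) := by
    intro p q
    simp only [hL, map_sub, inner_sub_left, inner_sub_right]
    ring
  have hder : ∀ r ∈ Set.Ici t0, HasDerivAt E
      (γ ^ 2 * ((⟪F' (x r), x' r⟫ + ⟪A (x' r), ystar⟫) + (⟪G' (y r), y' r⟫ - ⟪A xstar, y' r⟫))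
        + ⟪u r, x' r + γ • x'' r⟫ + ⟪v r, y' r + γ • y'' r⟫) r := by
    intro r hr
    have hFx : HasDerivAt (fun r => F (x r)) ⟪F' (x r), x' r⟫ r :=
      (hFdiff (x r)).hasFDerivAt.comp_hasDerivAt r (hx r hr)
    have hGy : HasDerivAt (fun r => G (y r)) ⟪G' (y r), y' r⟫ r :=
      (hGdiff (y r)).hasFDerivAt.comp_hasDerivAt r (hy r hr)
    have hAx : HasDerivAt (fun r => ⟪A (x r - xstar), ystar⟫) ⟪A (x' r), ystar⟫ r := by
      simpa using ((A.hasFDerivAt.comp_hasDerivAt r ((hx r hr).sub_const xstar)).inner ℝ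
        (hasDerivAt_const r ystar))
    have hAy : HasDerivAt (fun r => ⟪A xstar, y r - ystar⟫) ⟪A xstar, y' r⟫ r := by
      simpa using ((hasDerivAt_const r (A xstar)).inner ℝ ((hy r hr).sub_const ystar))
    have hud : HasDerivAt u (x' r + γ • x'' r) r := by
      rw [funext hu]
      exact ((hx r hr).sub_const xstar).add ((hx' r hr).const_smul γ)
    have hvd : HasDerivAt v (y' r + γ • y'' r) r := by
      rw [funext hv]
      exact ((hy r hr).sub_const ystar).add ((hy' r hr).const_smul γ)
    rw [funext hE]
    simp only [hgap]
    exact ((((((hFx.sub_const (F xstar)).add hAx).add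
      ((hGy.sub_const (G ystar)).sub hAy)).const_mul (γ ^ 2)).add
      (hud.norm_sq.const_mul (1 / 2))).add (hvd.norm_sq.const_mul (1 / 2))).congr_deriv (by ring)
  have hdiss : ∀ r ∈ Set.Ici t0,
      (γ ^ 2 * ((⟪F' (x r), x' r⟫ + ⟪A (x' r), ystar⟫) + (⟪G' (y r), y' r⟫ - ⟪A xstar, y' r⟫))
        + ⟪u r, x' r + γ • x'' r⟫ + ⟪v r, y' r + γ • y'' r⟫) + γ⁻¹ * E r ≤ 0 := by
    intro r hr
    have hX := inertial_dissipation_nonpos (d := x r - xstar) (w := x' r)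
      (p := F' (x r) + (ContinuousLinearMap.adjoint A) ystar)
      (e := F (x r) - F xstar + ⟪A (x r - xstar), ystar⟫) hγpos hγF (by
        have h := hFsc (x r) xstar
        rw [← neg_sub (x r) xstar, inner_neg_right, norm_neg] at h
        rw [Real.sq_sqrt hμF.le, inner_add_left, ContinuousLinearMap.adjoint_inner_left,
          real_inner_comm (A _) ystar]
        linarith)
    have hY := inertial_dissipation_nonpos (d := y r - ystar) (w := y' r)
      (p := G' (y r) - A xstar)
      (e := G (y r) - G ystar - ⟪A xstar, y r - ystar⟫) hγpos hγG (by
        have h := hGsc (y r) ystar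
        rw [← neg_sub (y r) ystar, inner_neg_right, norm_neg] at h
        rw [Real.sq_sqrt hμG.le, inner_sub_left]
        linarith)
    have hx2 : x'' r = -((2 * √μF) • x' r
        + (F' (x r) + (ContinuousLinearMap.adjoint A) ystar))
        - (ContinuousLinearMap.adjoint A) (v r) := by
      rw [← sub_eq_zero, ← hode1 r hr, hv]
      simp only [map_add, map_sub]
      abel
    have hy2 : y'' r = -((2 * √μG) • y' r + (G' (y r) - A xstar)) + A (u r) := by
      rw [← sub_eq_zero, ← hode2 r hr, hu]
      simp only [map_add, map_sub]
      abel
    have hu2 : ⟪u r, x' r + γ • x'' r⟫ = ⟪u r, x' r - γ • ((2 * √μF) • x' r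
        + (F' (x r) + (ContinuousLinearMap.adjoint A) ystar))⟫ - γ * ⟪A (u r), v r⟫ := by
      rw [hx2, ← ContinuousLinearMap.adjoint_inner_right, ← real_inner_smul_right,
        ← inner_sub_right, smul_sub, smul_neg]
      congr 1
      abel
    have hv2 : ⟪v r, y' r + γ • y'' r⟫ = ⟪v r, y' r - γ • ((2 * √μG) • y' r
        + (G' (y r) - A xstar))⟫ + γ * ⟪A (u r), v r⟫ := by
      rw [hy2, real_inner_comm (v r) (A (u r)), ← real_inner_smul_right, ← inner_add_right,
        smul_add, smul_neg]
      congr 1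
      abel
    rw [← hu, inner_add_left (F' (x r)), ContinuousLinearMap.adjoint_inner_left,
      real_inner_comm (A (x' r))] at hX
    rw [← hv, inner_sub_left (G' (y r))] at hY
    rw [hu2, hv2, hE, hgap]
    linarith
  have hdecay := le_mul_exp_of_hasDerivAt_add_mul_nonpos hder hdiss ht
  have hlower : γ ^ 2 * (μF / 2 * ‖x t - xstar‖ ^ 2 + μG / 2 * ‖y t - ystar‖ ^ 2) ≤ E t := by
    have h1 := hFsc xstar (x t)
    have h2 := hGsc ystar (y t)
    rw [hF0, inner_neg_left, ContinuousLinearMap.adjoint_inner_left, real_inner_comm] at h1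
    rw [hG0] at h2
    have h3 : μF / 2 * ‖x t - xstar‖ ^ 2 + μG / 2 * ‖y t - ystar‖ ^ 2 ≤
        L (x t) ystar - L xstar (y t) := by
      rw [hgap]
      linarith
    have h4 := mul_le_mul_of_nonneg_left h3 (sq_nonneg γ)
    rw [hE]
    linarith [sq_nonneg ‖u t‖, sq_nonneg ‖v t‖]
  rw [div_mul_eq_mul_div (E t0), le_div_iff₀ (by positivity), mul_comm, div_eq_inv_mul (t0 - t)]
  exact hlower.trans hdecay
end
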